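/- arXiv:2005.11390 — 4 statements merged into one kernel-verified Lean document; each statement's English description precedes it below -/
import Mathlib

section
/- Assume D^φφ = ω in the broad* sense on U for some continuous ω : U → ℝ^{k×(2n−k)}. Then φ is uniformly intrinsically differentiable on U, and at every a_0 ∈ U its intrinsic gradient satisfies ∇^φφ(a_0) = ω(a_0). -/
open MeasureTheory Filter Topology

namespace Heis

/-- The underlying space of the Heisenberg group `H^n = ℝ^(2n) × ℝ`. -/
abbrev H (n : ℕ) := (Fin (2 * n) → ℝ) × ℝ

/-- The index `i` among the first `n` horizontal coordinates. -/
def loIdx {n : ℕ} (i : Fin n) : Fin (2 * n) := ⟨(i : ℕ), by have := i.isLt; omega⟩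

/-- The index `n + i` among the last `n` horizontal coordinates. -/
def hiIdx {n : ℕ} (i : Fin n) : Fin (2 * n) := ⟨n + (i : ℕ), by have := i.isLt; omega⟩

/-- The Heisenberg group product. -/
noncomputable def hmul {n : ℕ} (p q : H n) : H n :=
  (p.1 + q.1, p.2 + q.2 + (1 / 2) * ∑ i : Fin n,
    (p.1 (loIdx i) * q.1 (hiIdx i) - p.1 (hiIdx i) * q.1 (loIdx i)))

/-- Group inverse `a⁻¹ = -a`. -/
def hinv {n : ℕ} (p : H n) : H n := (-p.1, -p.2)

/-- Homogeneous norm `‖a‖ = Σ_{j≤2n} |a_j| + |a_{2n+1}|^(1/2)`. -/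
noncomputable def hnormH {n : ℕ} (p : H n) : ℝ :=
  (∑ j, |p.1 j|) + Real.sqrt |p.2|

/-- Homogeneous (quasi-)distance `d(p,q) = ‖p⁻¹·q‖`. -/
noncomputable def hdist {n : ℕ} (p q : H n) : ℝ := hnormH (hmul (hinv p) q)

/-- Euclidean distance on `H^n`. -/
noncomputable def eDistH {n : ℕ} (p q : H n) : ℝ :=
  Real.sqrt ((∑ j, (p.1 j - q.1 j) ^ 2) + (p.2 - q.2) ^ 2)

/-- The subgroup `W = {x_1 = … = x_k = 0}`. -/
def WsetH (n k : ℕ) : Set (H n) := {p | ∀ j : Fin (2 * n), (j : ℕ) < k → p.1 j = 0}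

/-- `U` is (relatively) open in `W`. -/
def RelOpenH (n k : ℕ) (U : Set (H n)) : Prop :=
  ∃ O : Set (H n), IsOpen O ∧ U = O ∩ WsetH n k

/-- The graphing map `Φ(w) = (φ^(1)(w),…,φ^(k)(w),0,…,0) ∈ L`. -/
noncomputable def PhiH {n : ℕ} (k : ℕ) (φ : H n → Fin k → ℝ) (w : H n) : H n :=
  ((fun j => if hj : (j : ℕ) < k then φ w ⟨(j : ℕ), hj⟩ else 0), 0)

/-- The projected vector fields `D^φ_j` on `W` (0-based index `j`, used for `k ≤ j < 2n`):
`∂_{x_j} - (1/2)x_{n+j}∂_z` for `k ≤ j < n`; `∂_{x_{n+i}} + φ^(i)∂_z` for `j = n+i`, `i < k`;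
`∂_{x_{n+j'}} + (1/2)x_{j'}∂_z` for `j = n+j'`, `k ≤ j' < n`. -/
noncomputable def DvecH {n : ℕ} (k : ℕ) (φ : H n → Fin k → ℝ) (j : Fin (2 * n))
    (w : H n) : H n :=
  ((fun j' => if j' = j then 1 else 0),
   if hj : (j : ℕ) < n then -(1 / 2) * w.1 ⟨n + (j : ℕ), by omega⟩
   else if h2 : (j : ℕ) - n < k then φ w ⟨(j : ℕ) - n, h2⟩
   else (1 / 2) * w.1 ⟨(j : ℕ) - n, by have := j.isLt; omega⟩)

/-- `D^φφ = ω` in the broad* sense on `U ⊆ W ⊆ H^n`. -/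
def IsBroadStarH (n k : ℕ) (U : Set (H n)) (φ : H n → Fin k → ℝ)
    (ω : H n → Fin k → Fin (2 * n) → ℝ) : Prop :=
  ∀ a₀ ∈ U, ∃ δ₁ δ₂ : ℝ, 0 < δ₂ ∧ δ₂ < δ₁ ∧
    ∀ j : Fin (2 * n), k ≤ (j : ℕ) → ∃ E : H n → ℝ → H n,
      ∀ a, a ∈ U → eDistH a a₀ ≤ δ₂ →
        (∀ t ∈ Set.Icc (-δ₂) δ₂, E a t ∈ U ∧ eDistH (E a t) a₀ ≤ δ₁) ∧
        E a 0 = a ∧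
        (∀ t ∈ Set.Icc (-δ₂) δ₂,
          HasDerivWithinAt (E a) (DvecH k φ j (E a t)) (Set.Icc (-δ₂) δ₂) t) ∧
        (∀ t ∈ Set.Icc (-δ₂) δ₂, ∀ l : Fin k,
          φ (E a t) l - φ a l = ∫ s in (0:ℝ)..t, ω (E a s) l j)

/-- `φ` is uniformly intrinsically differentiable at `a₀` with intrinsic gradient
(the matrix) `grad`. -/
def UIDAtH (n k : ℕ) (U : Set (H n)) (φ : H n → Fin k → ℝ) (a₀ : H n)
    (grad : Fin k → Fin (2 * n) → ℝ) : Prop :=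
  ∀ ε > (0:ℝ), ∃ r > (0:ℝ), ∀ a ∈ U, ∀ b ∈ U,
    hdist a₀ a < r → hdist a₀ b < r → a ≠ b →
    Real.sqrt (∑ l : Fin k, (φ b l - φ a l -
        ∑ j ∈ Finset.univ.filter (fun j : Fin (2 * n) => k ≤ (j : ℕ)),
          grad l j * (b.1 j - a.1 j)) ^ 2)
      ≤ ε * hnormH (hmul (hmul (hmul (hinv (PhiH k φ a)) (hinv a)) b) (PhiH k φ a))

end Heis

namespace Heis

/-- A curve `γ` on `[0, ρ]` starting at `a` that follows `s • D^φ_j`, moves with speed at most `M`,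
and along which `φ` grows like `s * A l j` up to the error `ε`. -/
structure IsControlledFlow {n k : ℕ} (U : Set (H n)) (φ : H n → Fin k → ℝ)
    (A : Fin k → Fin (2 * n) → ℝ) (M ε ρ : ℝ) (j : Fin (2 * n)) (s : ℝ) (a : H n)
    (γ : ℝ → H n) : Prop where
  zero : γ 0 = a
  mem : ∀ t ∈ Set.Icc 0 ρ, γ t ∈ U
  deriv : ∀ t ∈ Set.Icc 0 ρ,
    HasDerivWithinAt γ (s • DvecH k φ j (γ t)) (Set.Icc 0 ρ) t
  fst : ∀ t ∈ Set.Icc 0 ρ, ∀ i, (γ t).1 i = a.1 i + if i = j then s * t else 0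
  dist_le : ∀ t ∈ Set.Icc 0 ρ, ‖γ t - a‖ ≤ M * t
  growth : ∀ t ∈ Set.Icc 0 ρ, ∀ l, |φ (γ t) l - φ a l - s * t * A l j| ≤ ε * t
  lipschitz : ∀ t ∈ Set.Icc 0 ρ, ∀ l, |φ (γ t) l - φ a l| ≤ M * t

theorem hasDerivWithinAt_prod_fst {E F : Type*} [NormedAddCommGroup E] [NormedSpace ℝ E]
    [NormedAddCommGroup F] [NormedSpace ℝ F] {f : ℝ → E × F} {f' : E × F} {S : Set ℝ} {t : ℝ}
    (h : HasDerivWithinAt f f' S t) : HasDerivWithinAt (fun x => (f x).1) f'.1 S t :=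
  (ContinuousLinearMap.fst ℝ E F).hasFDerivAt.comp_hasDerivWithinAt t h

theorem hasDerivWithinAt_prod_snd {E F : Type*} [NormedAddCommGroup E] [NormedSpace ℝ E]
    [NormedAddCommGroup F] [NormedSpace ℝ F] {f : ℝ → E × F} {f' : E × F} {S : Set ℝ} {t : ℝ}
    (h : HasDerivWithinAt f f' S t) : HasDerivWithinAt (fun x => (f x).2) f'.2 S t :=
  (ContinuousLinearMap.snd ℝ E F).hasFDerivAt.comp_hasDerivWithinAt t h

/-- A curve whose speed is less than `M` as long as it stays in a ball of radius `δ` moves by at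
most `M * t` in time `t`, as long as `M * t` does not allow it to leave the ball. -/
theorem norm_sub_le_of_speed_lt_on_ball {E : Type*} [NormedAddCommGroup E] [NormedSpace ℝ E]
    {f f' : ℝ → E} {M δ ρ : ℝ} {x₀ : E} (hM : 0 ≤ M) (hδ : ‖f 0 - x₀‖ + M * ρ < δ)
    (hf : ∀ t ∈ Set.Icc 0 ρ, HasDerivWithinAt f (f' t) (Set.Icc 0 ρ) t)
    (hf' : ∀ t ∈ Set.Icc 0 ρ, ‖f t - x₀‖ < δ → ‖f' t‖ < M) :
    ∀ t ∈ Set.Icc 0 ρ, ‖f t - f 0‖ ≤ M * t := by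
  refine image_norm_le_of_norm_deriv_right_lt_deriv_boundary (f := fun t => f t - f 0) (f' := f')
    (B := fun t => M * t) (B' := fun _ => M)
    (fun t ht => ((hf t ht).sub_const _).continuousWithinAt)
    (fun t ht => ?_) (by simp) (fun t => by simpa using (hasDerivAt_id t).const_mul M) ?_
  · exact ((hf t ⟨ht.1, ht.2.le⟩).sub_const _).mono_of_mem_nhdsWithin (Icc_mem_nhdsGE_of_mem ht)
  · intro t ht h
    refine hf' t ⟨ht.1, ht.2.le⟩ ?_
    have h1 : ‖f t - x₀‖ ≤ ‖f t - f 0‖ + ‖f 0 - x₀‖ := norm_sub_le_norm_sub_add_norm_sub _ _ _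
    have h2 : M * t ≤ M * ρ := mul_le_mul_of_nonneg_left ht.2.le hM
    linarith

theorem continuousWithinAt_DvecH {n k : ℕ} {U : Set (H n)} {φ : H n → Fin k → ℝ}
    (hφ : ContinuousOn φ U) {a : H n} (ha : a ∈ U) (j : Fin (2 * n)) :
    ContinuousWithinAt (DvecH k φ j) U a := by
  have hx : ∀ i, ContinuousWithinAt (fun w : H n => w.1 i) U a := fun i => by fun_prop
  refine ContinuousWithinAt.prodMk continuousWithinAt_const ?_
  split_ifs with h1 h2
  · exact continuousWithinAt_const.mul (hx _)
  · exact continuousWithinAt_pi.1 (hφ a ha) _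
  · exact continuousWithinAt_const.mul (hx _)

theorem eventually_nhds_eDistH_lt {n : ℕ} (a₀ : H n) {δ : ℝ} (hδ : 0 < δ) :
    ∀ᶠ a in 𝓝 a₀, eDistH a a₀ < δ := by
  have hc : Continuous fun a => eDistH a a₀ := by unfold eDistH; fun_prop
  refine (hc.tendsto a₀).eventually_lt_const ?_
  simpa [eDistH] using hδ

theorem exists_isControlledFlow {n k : ℕ} {U : Set (H n)} {φ : H n → Fin k → ℝ}
    (hφ : ContinuousOn φ U) {ω : H n → Fin k → Fin (2 * n) → ℝ}
    (hω : ∀ l : Fin k, ∀ j : Fin (2 * n), k ≤ (j : ℕ) → ContinuousOn (fun w => ω w l j) U)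
    (hbroad : IsBroadStarH n k U φ ω) {a₀ : H n} (ha₀ : a₀ ∈ U) :
    ∃ M, 1 ≤ M ∧ ∀ ε > 0, ∃ ρ > 0, ∀ j : Fin (2 * n), k ≤ (j : ℕ) → ∀ s : ℝ, |s| = 1 →
      ∀ a ∈ U, ‖a - a₀‖ < ρ → ∃ γ, IsControlledFlow U φ (ω a₀) M ε ρ j s a γ := by
  set M : ℝ := ∑ j, ‖DvecH k φ j a₀‖ + ∑ l, ∑ j, |ω a₀ l j| + 1 with hM
  have hM1 : 1 ≤ M := by
    have : 0 ≤ ∑ j, ‖DvecH k φ j a₀‖ + ∑ l, ∑ j, |ω a₀ l j| := by positivity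
    linarith
  have hD0 : ∀ j, ‖DvecH k φ j a₀‖ < M := fun j => by
    have h1 := Finset.single_le_sum (f := fun j => ‖DvecH k φ j a₀‖)
      (fun _ _ => norm_nonneg _) (Finset.mem_univ j)
    have h2 : 0 ≤ ∑ l, ∑ j, |ω a₀ l j| := by positivity
    linarith
  have hω0 : ∀ l j, |ω a₀ l j| < M := fun l j => by
    have h1 := Finset.single_le_sum (f := fun j => |ω a₀ l j|)
      (fun _ _ => abs_nonneg _) (Finset.mem_univ j)
    have h2 := Finset.single_le_sum (f := fun l => ∑ j, |ω a₀ l j|)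
      (fun _ _ => by positivity) (Finset.mem_univ l)
    have h3 : 0 ≤ ∑ j, ‖DvecH k φ j a₀‖ := by positivity
    linarith
  refine ⟨M, hM1, fun ε hε => ?_⟩
  obtain ⟨δ₁, δ₂, hδ₂, -, hE⟩ := hbroad a₀ ha₀
  have hev : ∀ᶠ w in 𝓝[U] a₀, (∀ j, ‖DvecH k φ j w‖ < M) ∧
      ∀ l, ∀ j : Fin (2 * n), k ≤ (j : ℕ) → |ω w l j - ω a₀ l j| < ε ∧ |ω w l j| < M := by
    refine (eventually_all.2 fun j => ?_).and (eventually_all.2 fun l => eventually_all.2 fun j =>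
      eventually_all.2 fun hj => ?_)
    · exact (continuousWithinAt_DvecH hφ ha₀ j).norm.tendsto.eventually_lt_const (hD0 j)
    · have hc := hω l j hj a₀ ha₀
      refine (Tendsto.eventually_lt_const ?_ (hc.sub continuousWithinAt_const).abs.tendsto).and
        (hc.abs.tendsto.eventually_lt_const (hω0 l j))
      simpa using hε
  rw [eventually_nhdsWithin_iff] at hev
  obtain ⟨δ, hδ, hball⟩ := Metric.eventually_nhds_iff_ball.1
    (hev.and (eventually_nhds_eDistH_lt a₀ hδ₂))
  have hMpos : 0 < M := by linarith
  refine ⟨min δ₂ (δ / (M + 2)), by positivity, fun j hj s hs a ha haρ => ?_⟩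
  set ρ := min δ₂ (δ / (M + 2)) with hρ
  have hρ0 : 0 < ρ := by positivity
  have hρδ₂ : ρ ≤ δ₂ := min_le_left _ _
  have hρδ : ρ * (M + 2) ≤ δ := (le_div_iff₀ (by positivity)).1 (min_le_right _ _)
  have haδ : ‖a - a₀‖ + M * ρ < δ := by nlinarith
  obtain ⟨E, hE⟩ := hE j hj
  obtain ⟨hEU, hE0, hEd, hEφ⟩ := hE a ha
    (hball a (by rw [mem_ball_iff_norm]; nlinarith [norm_nonneg (a - a₀)])).2.le
  have hst : ∀ t ∈ Set.Icc 0 ρ, s * t ∈ Set.Icc (-δ₂) δ₂ := fun t ht => by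
    rw [Set.mem_Icc, ← abs_le, abs_mul, hs, one_mul, abs_of_nonneg ht.1]
    exact ht.2.trans hρδ₂
  have hderiv : ∀ t ∈ Set.Icc 0 ρ, HasDerivWithinAt (fun t => E a (s * t))
      (s • DvecH k φ j (E a (s * t))) (Set.Icc 0 ρ) t := fun t ht =>
    HasDerivWithinAt.scomp t (hEd _ (hst t ht))
      (by simpa using (hasDerivWithinAt_id t (Set.Icc 0 ρ)).const_mul s) hst
  have hnorm : ∀ v : H n, ‖s • v‖ = ‖v‖ := fun v => by rw [norm_smul, Real.norm_eq_abs, hs, one_mul]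
  have hdist : ∀ t ∈ Set.Icc 0 ρ, ‖E a (s * t) - a‖ ≤ M * t := by
    have := norm_sub_le_of_speed_lt_on_ball (f := fun t => E a (s * t)) (x₀ := a₀) (δ := δ)
      hMpos.le (by simpa [hE0] using haδ) hderiv (fun t ht h => by
        rw [hnorm]
        exact ((hball _ (mem_ball_iff_norm.2 h)).1 (hEU _ (hst t ht)).1).1 j)
    simpa [hE0] using this
  have hin : ∀ t ∈ Set.Icc 0 ρ, E a (s * t) ∈ Metric.ball a₀ δ := fun t ht => by
    rw [mem_ball_iff_norm]
    have h1 := norm_sub_le_norm_sub_add_norm_sub (E a (s * t)) a a₀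
    have h2 : M * t ≤ M * ρ := mul_le_mul_of_nonneg_left ht.2 hMpos.le
    linarith [hdist t ht]
  have hpath : ∀ t ∈ Set.Icc 0 ρ, ∀ x ∈ Set.uIcc 0 (s * t), ∃ t' ∈ Set.Icc 0 ρ, x = s * t' := by
    intro t ht x hx
    have hss : s * s = 1 := by rw [← abs_mul_abs_self, hs, one_mul]
    refine ⟨s * x, ?_, by rw [← mul_assoc, hss, one_mul]⟩
    rcases (abs_eq zero_le_one).1 hs with rfl | rfl
    · rw [one_mul, Set.uIcc_of_le ht.1] at hx
      exact ⟨by linarith [hx.1], by linarith [hx.2, ht.2]⟩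
    · rw [neg_one_mul, Set.uIcc_of_ge (by linarith [ht.1])] at hx
      exact ⟨by linarith [hx.2], by linarith [hx.1, ht.2]⟩
  have hωE : ∀ t ∈ Set.Icc 0 ρ, ∀ x ∈ Set.uIcc 0 (s * t), ∀ l,
      |ω (E a x) l j - ω a₀ l j| < ε ∧ |ω (E a x) l j| < M := fun t ht x hx l => by
    obtain ⟨t', ht', rfl⟩ := hpath t ht x hx
    exact ((hball _ (hin t' ht')).1 (hEU _ (hst t' ht')).1).2 l j hj
  have habs : ∀ t ∈ Set.Icc 0 ρ, |s * t - 0| = t := fun t ht => by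
    rw [sub_zero, abs_mul, hs, one_mul, abs_of_nonneg ht.1]
  refine ⟨fun t => E a (s * t), by simpa using hE0, fun t ht => (hEU _ (hst t ht)).1, hderiv,
    fun t ht i => ?_, hdist, fun t ht l => ?_, fun t ht l => ?_⟩
  · have hd : ∀ x ∈ Set.Icc 0 ρ, HasDerivWithinAt
        (fun t => (E a (s * t)).1 i - if i = j then s * t else 0) 0 (Set.Icc 0 ρ) x := by
      intro x hx
      have h1 := hasDerivWithinAt_pi.1 (hasDerivWithinAt_prod_fst (hderiv x hx)) i
      have h2 : HasDerivWithinAt (fun t => if i = j then s * t else 0) (if i = j then s else 0)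
          (Set.Icc 0 ρ) x := by
        split_ifs
        · simpa using (hasDerivWithinAt_id x (Set.Icc 0 ρ)).const_mul s
        · exact hasDerivWithinAt_const _ _ _
      refine (h1.sub h2).congr_deriv ?_
      simp [DvecH]
    have h := norm_image_sub_le_of_norm_deriv_le_segment' (C := 0) hd (by simp) t ht
    simp only [mul_zero, ite_self, hE0, sub_zero, zero_mul, norm_le_zero_iff] at h
    linarith
  · rw [hEφ _ (hst t ht)]
    have hcont : ContinuousOn (fun x => ω (E a x) l j) (Set.uIcc 0 (s * t)) := by
      refine ((hω l j hj).comp (fun x hx => (hEd x hx).continuousWithinAt)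
        (fun x hx => (hEU x hx).1)).mono fun x hx => ?_
      obtain ⟨t', ht', rfl⟩ := hpath t ht x hx
      exact hst t' ht'
    have hsub := intervalIntegral.integral_sub hcont.intervalIntegrable
      (intervalIntegrable_const (μ := volume) (a := 0) (b := s * t) (c := ω a₀ l j))
    rw [intervalIntegral.integral_const, sub_zero, smul_eq_mul] at hsub
    rw [← hsub, ← Real.norm_eq_abs]
    have := intervalIntegral.norm_integral_le_of_norm_le_const (a := 0) (b := s * t) (C := ε)
      (f := fun x => ω (E a x) l j - ω a₀ l j)
      (fun x hx => (hωE t ht x (Set.uIoc_subset_uIcc hx) l).1.le)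
    rwa [habs t ht] at this
  · rw [hEφ _ (hst t ht), ← Real.norm_eq_abs]
    have := intervalIntegral.norm_integral_le_of_norm_le_const (a := 0) (b := s * t) (C := M)
      (f := fun x => ω (E a x) l j)
      (fun x hx => (hωE t ht x (Set.uIoc_subset_uIcc hx) l).2.le)
    rwa [habs t ht] at this

theorem DvecH_hiIdx_snd {n k : ℕ} (hkn : k < n) (φ : H n → Fin k → ℝ) (l : Fin k) (w : H n) :
    (DvecH k φ (hiIdx (l.castLE hkn.le)) w).2 = φ w l := by
  simp [DvecH, hiIdx]

/-- `φ` is little `1/2`-Hölder along the vertical direction: otherwise the flow lines of the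
vector field `∂_{x_{n+l}} + φ^(l) ∂_z` through two points on a vertical line would meet at a point
where `φ^(l)` takes two different values. -/
theorem exists_vertical_holder {n k : ℕ} (hkn : k < n) {U : Set (H n)} {φ : H n → Fin k → ℝ}
    {A : Fin k → Fin (2 * n) → ℝ} {a₀ : H n} {M : ℝ}
    (hflow : ∀ ε > 0, ∃ ρ > 0, ∀ j : Fin (2 * n), k ≤ (j : ℕ) → ∀ s : ℝ, |s| = 1 →
      ∀ a ∈ U, ‖a - a₀‖ < ρ → ∃ γ, IsControlledFlow U φ A M ε ρ j s a γ) {ε : ℝ} (hε : 0 < ε) :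
    ∃ ρ > 0, ∀ p ∈ U, ∀ q ∈ U, ‖p - a₀‖ < ρ → ‖q - a₀‖ < ρ → p.1 = q.1 →
      ∀ l, |φ q l - φ p l| ≤ ε * √|q.2 - p.2| := by
  obtain ⟨ρ, hρ, hflow⟩ := hflow (ε ^ 2 / 8) (by positivity)
  refine ⟨min ρ (ε ^ 2 * ρ ^ 2 / 8), by positivity, ?_⟩
  suffices key : ∀ p ∈ U, ∀ q ∈ U, ‖p - a₀‖ < min ρ (ε ^ 2 * ρ ^ 2 / 8) →
      ‖q - a₀‖ < min ρ (ε ^ 2 * ρ ^ 2 / 8) → p.1 = q.1 → p.2 ≤ q.2 →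
      ∀ l, |φ q l - φ p l| ≤ ε * √|q.2 - p.2| by
    intro p hp q hq hpρ hqρ hpq l
    rcases le_total p.2 q.2 with h | h
    · exact key p hp q hq hpρ hqρ hpq h l
    · rw [abs_sub_comm, abs_sub_comm q.2]
      exact key q hq p hp hqρ hpρ hpq.symm h l
  intro p hp q hq hpρ hqρ hpq hle l
  rw [lt_min_iff] at hpρ hqρ
  by_contra! hlt
  set d := φ q l - φ p l with hd
  set Δ := q.2 - p.2 with hΔ
  have hΔ0 : 0 ≤ Δ := by linarith
  have hd0 : 0 < |d| := lt_of_le_of_lt (by positivity) hlt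
  have hdsq : ε ^ 2 * Δ < |d| ^ 2 := by
    have := pow_lt_pow_left₀ hlt (by positivity) two_ne_zero
    rwa [mul_pow, Real.sq_sqrt (abs_nonneg _), abs_of_nonneg hΔ0] at this
  have hΔlt : Δ < ε ^ 2 * ρ ^ 2 / 4 := by
    have h1 := (norm_snd_le (p - a₀)).trans_lt hpρ.2
    have h2 := (norm_snd_le (q - a₀)).trans_lt hqρ.2
    rw [Prod.snd_sub, Real.norm_eq_abs, abs_lt] at h1 h2
    linarith [h1.1, h2.2]
  set T := 2 * Δ / |d| with hT
  have hT0 : 0 ≤ T := by positivity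
  have hTd : T * |d| = 2 * Δ := div_mul_cancel₀ _ hd0.ne'
  have hTρ : T ≤ ρ := by
    have h1 : (ε * T) ^ 2 * |d| ^ 2 ≤ (ε * ρ) ^ 2 * |d| ^ 2 := by
      have : (ε * T) ^ 2 * |d| ^ 2 = ε ^ 2 * (2 * Δ) ^ 2 := by rw [← hTd]; ring
      rw [this]
      nlinarith [mul_le_mul hΔlt.le hdsq.le (by positivity) (by positivity)]
    have h2 := le_of_mul_le_mul_right h1 (by positivity)
    have h3 := (sq_le_sq₀ (by positivity) (by positivity)).1 h2
    exact le_of_mul_le_mul_left h3 hε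
  have hTε : ε ^ 2 * T < 2 * |d| := by
    refine lt_of_mul_lt_mul_right (a := |d|) ?_ hd0.le
    calc ε ^ 2 * T * |d| = 2 * (ε ^ 2 * Δ) := by rw [mul_assoc, hTd]; ring
      _ < 2 * |d| ^ 2 := by linarith
      _ = 2 * |d| * |d| := by ring
  obtain ⟨s, hs, hsd⟩ : ∃ s : ℝ, |s| = 1 ∧ s * d = -|d| := by
    rcases le_total 0 d with h | h
    · exact ⟨-1, by simp, by rw [abs_of_nonneg h]; ring⟩
    · exact ⟨1, by simp, by rw [abs_of_nonpos h]; ring⟩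
  set j : Fin (2 * n) := hiIdx (l.castLE hkn.le) with hj
  have hkj : k ≤ (j : ℕ) := by simp only [hj, hiIdx]; omega
  obtain ⟨γp, hγp⟩ := hflow j hkj s hs p hp hpρ.1
  obtain ⟨γq, hγq⟩ := hflow j hkj s hs q hq hqρ.1
  have hsub : Set.Icc 0 T ⊆ Set.Icc 0 ρ := Set.Icc_subset_Icc_right hTρ
  set u : ℝ → ℝ := fun t => s * (φ (γq t) l - φ (γp t) l) with hu
  have hule : ∀ t ∈ Set.Icc 0 T, u t ≤ -(|d| / 2) := fun t ht => by
    have h1 := hγp.growth t (hsub ht) l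
    have h2 := hγq.growth t (hsub ht) l
    have h3 : u t - s * d = s * ((φ (γq t) l - φ q l - s * t * A l j)
        - (φ (γp t) l - φ p l - s * t * A l j)) := by simp only [hu, hd]; ring
    have h4 : |u t - s * d| ≤ ε ^ 2 / 8 * t + ε ^ 2 / 8 * t := by
      rw [h3, abs_mul, hs, one_mul]
      exact (abs_sub _ _).trans (add_le_add h2 h1)
    have h5 : ε ^ 2 * t ≤ ε ^ 2 * T := mul_le_mul_of_nonneg_left ht.2 (by positivity)
    have h6 := (le_abs_self _).trans h4
    linarith
  have hg : ∀ t ∈ Set.Icc 0 T, HasDerivWithinAt (fun t => (γq t).2 - (γp t).2) (u t)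
      (Set.Icc 0 T) t := fun t ht => by
    have h1 := hasDerivWithinAt_prod_snd ((hγq.deriv t (hsub ht)).mono hsub)
    have h2 := hasDerivWithinAt_prod_snd ((hγp.deriv t (hsub ht)).mono hsub)
    refine (h1.sub h2).congr_deriv ?_
    simp only [Prod.smul_snd, hj, DvecH_hiIdx_snd hkn, smul_eq_mul, hu]
    ring
  have hgT : (γq T).2 - (γp T).2 ≤ 0 := by
    have hc := (convex_Icc (0 : ℝ) T).image_sub_le_mul_sub_of_deriv_le
      (f := fun t => (γq t).2 - (γp t).2) (C := -(|d| / 2))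
      (fun t ht => (hg t ht).continuousWithinAt)
      (fun t ht => by
        rw [interior_Icc] at ht
        exact ((hg t (Set.Ioo_subset_Icc_self ht)).hasDerivAt
          (Icc_mem_nhds ht.1 ht.2)).differentiableAt.differentiableWithinAt)
      (fun t ht => by
        rw [interior_Icc] at ht
        rw [((hg t (Set.Ioo_subset_Icc_self ht)).hasDerivAt (Icc_mem_nhds ht.1 ht.2)).deriv]
        exact hule t (Set.Ioo_subset_Icc_self ht))
      0 ⟨le_rfl, hT0⟩ T ⟨hT0, le_rfl⟩ hT0
    simp only [hγp.zero, hγq.zero] at hc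
    linarith
  obtain ⟨t, ht, ht0⟩ := intermediate_value_Icc' hT0
    (fun t ht => (hg t ht).continuousWithinAt) (show (0 : ℝ) ∈ Set.Icc _ _ from
      ⟨hgT, by simpa only [hγp.zero, hγq.zero] using hΔ0⟩)
  have heq : γq t = γp t := by
    refine Prod.ext (funext fun i => ?_) (sub_eq_zero.1 ht0)
    rw [hγp.fst t (hsub ht), hγq.fst t (hsub ht), hpq]
  have := hule t ht
  simp only [hu, heq, sub_self, mul_zero] at this
  linarith

/-- The element `Φ(a)⁻¹ · a⁻¹ · b · Φ(a)` measuring the intrinsic distance from `a` to `b`. -/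
noncomputable def graphDiff {n : ℕ} (k : ℕ) (φ : H n → Fin k → ℝ) (a b : H n) : H n :=
  hmul (hmul (hmul (hinv (PhiH k φ a)) (hinv a)) b) (PhiH k φ a)

theorem graphDiff_fst {n k : ℕ} (φ : H n → Fin k → ℝ) (a b : H n) :
    (graphDiff k φ a b).1 = b.1 - a.1 := by
  simp only [graphDiff, hmul, hinv]
  abel

/-- The linear part of the affine map `b ↦ (graphDiff k φ a b).2`. -/
noncomputable def graphDiffLin {n : ℕ} (k : ℕ) (φ : H n → Fin k → ℝ) (a v : H n) : ℝ :=
  v.2 - ∑ i : Fin n, ((PhiH k φ a).1 (loIdx i) * v.1 (hiIdx i) +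
    1 / 2 * (a.1 (loIdx i) * v.1 (hiIdx i) - a.1 (hiIdx i) * v.1 (loIdx i)))

theorem graphDiff_snd {n k : ℕ} (hkn : k < n) (φ : H n → Fin k → ℝ) (a b : H n) :
    (graphDiff k φ a b).2 = graphDiffLin k φ a (b - a) := by
  have h : ∀ i : Fin n, (PhiH k φ a).1 (hiIdx i) = 0 := fun i => by
    simp only [PhiH, hiIdx]
    rw [dif_neg (by omega)]
  simp only [graphDiff, graphDiffLin, hmul, hinv, Pi.add_apply, Pi.neg_apply, h, Prod.fst_sub,
    Prod.snd_sub, Pi.sub_apply, Finset.mul_sum]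
  rw [show (PhiH k φ a).2 = 0 from rfl, sub_eq_add_neg (b.2 - a.2), ← Finset.sum_neg_distrib]
  trans b.2 - a.2 + (∑ i : Fin n, 1 / 2 * (-(PhiH k φ a).1 (loIdx i) * -a.1 (hiIdx i) -
      -0 * -a.1 (loIdx i)) + ∑ i : Fin n, 1 / 2 * ((-(PhiH k φ a).1 (loIdx i) + -a.1 (loIdx i)) *
      b.1 (hiIdx i) - (-0 + -a.1 (hiIdx i)) * b.1 (loIdx i)) +
      ∑ i : Fin n, 1 / 2 * ((-(PhiH k φ a).1 (loIdx i) + -a.1 (loIdx i) + b.1 (loIdx i)) * 0 -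
      (-0 + -a.1 (hiIdx i) + b.1 (hiIdx i)) * (PhiH k φ a).1 (loIdx i)))
  · ring
  · simp only [← Finset.sum_add_distrib]
    congr 1
    exact Finset.sum_congr rfl fun i _ => by ring

theorem graphDiffLin_smul {n k : ℕ} (φ : H n → Fin k → ℝ) (a v : H n) (s : ℝ) :
    graphDiffLin k φ a (s • v) = s * graphDiffLin k φ a v := by
  simp only [graphDiffLin, Prod.smul_fst, Prod.smul_snd, Pi.smul_apply, smul_eq_mul, mul_sub,
    Finset.mul_sum]
  congr 1
  exact Finset.sum_congr rfl fun i _ => by ring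

theorem hasDerivWithinAt_graphDiffLin {n k : ℕ} (φ : H n → Fin k → ℝ) (a : H n)
    {γ : ℝ → H n} {v : H n} {S : Set ℝ} {t : ℝ} (h : HasDerivWithinAt γ v S t) :
    HasDerivWithinAt (fun t => graphDiffLin k φ a (γ t)) (graphDiffLin k φ a v) S t := by
  have h1 := hasDerivWithinAt_pi.1 (hasDerivWithinAt_prod_fst h)
  exact (hasDerivWithinAt_prod_snd h).sub (HasDerivWithinAt.fun_sum fun i _ =>
    ((h1 _).const_mul _).add ((((h1 _).const_mul _).sub ((h1 _).const_mul _)).const_mul _))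

theorem abs_graphDiffLin_DvecH_le {n k : ℕ} (φ : H n → Fin k → ℝ) {a w : H n}
    (ha : a ∈ WsetH n k) {C : ℝ} (hw : ‖w - a‖ ≤ C) (hφ : ∀ l, |φ w l - φ a l| ≤ C)
    (j : Fin (2 * n)) : |graphDiffLin k φ a (DvecH k φ j w)| ≤ C := by
  have hcoord : ∀ i, |w.1 i - a.1 i| ≤ C := fun i =>
    (norm_le_pi_norm (w - a).1 i).trans ((norm_fst_le (w - a)).trans hw)
  have hlo : ∀ i i' : Fin n, (loIdx i = loIdx i') = (i = i') := fun i i' => by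
    simp [loIdx, Fin.ext_iff]
  have hhi : ∀ i i' : Fin n, (hiIdx i = hiIdx i') = (i = i') := fun i i' => by
    simp [hiIdx, Fin.ext_iff]
  have hlh : ∀ i i' : Fin n, (loIdx i = hiIdx i') = False := fun i i' => by
    simp only [loIdx, hiIdx, Fin.ext_iff, eq_iff_iff, iff_false]; omega
  have hhl : ∀ i i' : Fin n, (hiIdx i = loIdx i') = False := fun i i' => by
    simp only [loIdx, hiIdx, Fin.ext_iff, eq_iff_iff, iff_false]; omega
  by_cases hj : (j : ℕ) < n
  · obtain ⟨i, rfl⟩ : ∃ i : Fin n, j = loIdx i := ⟨⟨j, hj⟩, rfl⟩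
    have : graphDiffLin k φ a (DvecH k φ (loIdx i) w) =
        -(1 / 2) * (w.1 (hiIdx i) - a.1 (hiIdx i)) := by
      simp only [graphDiffLin, DvecH, hlo, hhl]
      rw [Finset.sum_eq_single i (fun i' _ h => by simp [h]) (by simp)]
      simp [loIdx, hiIdx]
      ring
    rw [this, abs_mul]
    have := hcoord (hiIdx i)
    norm_num
    linarith [abs_nonneg (w.1 (hiIdx i) - a.1 (hiIdx i))]
  · obtain ⟨i, rfl⟩ : ∃ i : Fin n, j = hiIdx i :=
      ⟨⟨j - n, by omega⟩, by simp only [hiIdx, Fin.ext_iff]; omega⟩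
    by_cases hik : (i : ℕ) < k
    · have : graphDiffLin k φ a (DvecH k φ (hiIdx i) w) = φ w ⟨i, hik⟩ - φ a ⟨i, hik⟩ := by
        have ha0 : a.1 (loIdx i) = 0 := ha _ hik
        simp only [graphDiffLin, DvecH, hhi, hlh]
        rw [Finset.sum_eq_single i (fun i' _ h => by simp [h]) (by simp)]
        simp [ha0, PhiH]
        simp [hiIdx, loIdx, hik]
      rw [this]
      exact hφ _
    · have : graphDiffLin k φ a (DvecH k φ (hiIdx i) w) =
          1 / 2 * (w.1 (loIdx i) - a.1 (loIdx i)) := by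
        simp only [graphDiffLin, DvecH, hhi, hlh]
        rw [Finset.sum_eq_single i (fun i' _ h => by simp [h]) (by simp)]
        simp [PhiH]
        simp [loIdx, hiIdx, hik]
        ring
      rw [this, abs_mul]
      have := hcoord (loIdx i)
      norm_num
      linarith [abs_nonneg (w.1 (loIdx i) - a.1 (loIdx i))]

/-- Following the flows of the fields `D^φ_j`, `j ∈ s`, one after the other leads from `a` to a
point `c` whose coordinates of index in `s` agree with those of `b`. -/
theorem exists_flow_chain {n k : ℕ} (hkn : k < n) {U : Set (H n)} (hUW : U ⊆ WsetH n k)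
    {φ : H n → Fin k → ℝ} {A : Fin k → Fin (2 * n) → ℝ} {a₀ : H n} {M ε ρ : ℝ} (hM : 1 ≤ M)
    (hflow : ∀ j : Fin (2 * n), k ≤ (j : ℕ) → ∀ s : ℝ, |s| = 1 →
      ∀ a ∈ U, ‖a - a₀‖ < ρ → ∃ γ, IsControlledFlow U φ A M ε ρ j s a γ)
    {a b : H n} (ha : a ∈ U) (hab : ‖a - a₀‖ + M * ∑ j, |b.1 j - a.1 j| < ρ)
    (s : Finset (Fin (2 * n))) (hs : ∀ j ∈ s, k ≤ (j : ℕ)) :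
    ∃ c ∈ U, (∀ j, c.1 j = if j ∈ s then b.1 j else a.1 j) ∧
      ‖c - a‖ ≤ M * ∑ j ∈ s, |b.1 j - a.1 j| ∧
      (∀ l, |φ c l - φ a l - ∑ j ∈ s, A l j * (b.1 j - a.1 j)| ≤
        ε * ∑ j ∈ s, |b.1 j - a.1 j|) ∧
      (∀ l, |φ c l - φ a l| ≤ M * ∑ j ∈ s, |b.1 j - a.1 j|) ∧
      |(graphDiff k φ a c).2| ≤ M * (∑ j ∈ s, |b.1 j - a.1 j|) ^ 2 := by
  induction s using Finset.induction_on with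
  | empty =>
    refine ⟨a, ha, by simp, by simp, by simp, by simp, ?_⟩
    simp [graphDiff_snd hkn, graphDiffLin]
  | insert j s hjs ih =>
    obtain ⟨c, hcU, hc1, hca, hcA, hcM, hcV⟩ := ih fun i hi => hs i (Finset.mem_insert_of_mem hi)
    simp only [Finset.sum_insert hjs]
    set S := ∑ j ∈ s, |b.1 j - a.1 j| with hS
    set h := |b.1 j - a.1 j| with hh
    have hS0 : 0 ≤ S := Finset.sum_nonneg fun _ _ => abs_nonneg _
    have hh0 : 0 ≤ h := abs_nonneg _
    have hhS : h + S ≤ ∑ j, |b.1 j - a.1 j| := by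
      rw [hh, hS, ← Finset.sum_insert (f := fun j => |b.1 j - a.1 j|) hjs]
      exact Finset.sum_le_sum_of_subset_of_nonneg (Finset.subset_univ _) fun _ _ _ => abs_nonneg _
    have hMS : M * (h + S) ≤ M * ∑ j, |b.1 j - a.1 j| :=
      mul_le_mul_of_nonneg_left hhS (by linarith)
    have hMh : h ≤ M * h := le_mul_of_one_le_left hh0 hM
    have hMS0 : 0 ≤ M * S := by positivity
    have hhρ : h ≤ ρ := by nlinarith [norm_nonneg (a - a₀)]
    have hca₀ : ‖c - a₀‖ < ρ := by
      have := norm_sub_le_norm_sub_add_norm_sub c a a₀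
      nlinarith
    obtain ⟨σ, hσ, hσh⟩ : ∃ σ : ℝ, |σ| = 1 ∧ σ * h = b.1 j - a.1 j := by
      rcases le_total 0 (b.1 j - a.1 j) with h' | h'
      · exact ⟨1, by simp, by rw [hh, abs_of_nonneg h']; ring⟩
      · exact ⟨-1, by simp, by rw [hh, abs_of_nonpos h']; ring⟩
    obtain ⟨γ, hγ⟩ := hflow j (hs j (Finset.mem_insert_self _ _)) σ hσ c hcU hca₀
    have hmem : h ∈ Set.Icc 0 ρ := ⟨hh0, hhρ⟩
    have hsub : Set.Icc 0 h ⊆ Set.Icc 0 ρ := Set.Icc_subset_Icc_right hhρ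
    have hγa : ∀ t ∈ Set.Icc 0 h, ‖γ t - a‖ ≤ M * (h + S) := fun t ht => by
      have h1 := norm_sub_le_norm_sub_add_norm_sub (γ t) c a
      have h2 := hγ.dist_le t (hsub ht)
      have h3 : M * t ≤ M * h := mul_le_mul_of_nonneg_left ht.2 (by linarith)
      linarith
    have hγφ : ∀ t ∈ Set.Icc 0 h, ∀ l, |φ (γ t) l - φ a l| ≤ M * (h + S) := fun t ht l => by
      have h1 := abs_sub_le (φ (γ t) l) (φ c l) (φ a l)
      have h2 := hγ.lipschitz t (hsub ht) l
      have h3 : M * t ≤ M * h := mul_le_mul_of_nonneg_left ht.2 (by linarith)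
      linarith [hcM l]
    have hhh : h ∈ Set.Icc 0 h := ⟨hh0, le_rfl⟩
    refine ⟨γ h, hγ.mem h hmem, fun i => ?_, hγa h hhh, fun l => ?_, hγφ h hhh, ?_⟩
    · rw [hγ.fst h hmem, hc1 i, hσh]
      by_cases hij : i = j
      · subst hij
        simp [hjs]
      · simp [hij]
    · have h1 := hγ.growth h hmem l
      rw [hσh] at h1
      have h2 := abs_add_le (φ (γ h) l - φ c l - (b.1 j - a.1 j) * A l j)
        (φ c l - φ a l - ∑ j ∈ s, A l j * (b.1 j - a.1 j))
      rw [show φ (γ h) l - φ a l - (A l j * (b.1 j - a.1 j) +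
        ∑ j ∈ s, A l j * (b.1 j - a.1 j)) = φ (γ h) l - φ c l - (b.1 j - a.1 j) * A l j +
        (φ c l - φ a l - ∑ j ∈ s, A l j * (b.1 j - a.1 j)) by ring]
      linarith [hcA l]
    · have hd := norm_image_sub_le_of_norm_deriv_le_segment' (C := M * (h + S)) (a := 0) (b := h)
        (fun t ht => hasDerivWithinAt_graphDiffLin φ a
          (((hγ.deriv t (hsub ht)).mono hsub).sub_const a))
        (fun t ht => by
          have ht' := Set.Ico_subset_Icc_self ht
          have := abs_graphDiffLin_DvecH_le φ (hUW ha) (hγa t ht') (hγφ t ht') j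
          rwa [graphDiffLin_smul, norm_mul, Real.norm_eq_abs, hσ, one_mul, Real.norm_eq_abs])
        h hhh
      rw [hγ.zero, ← graphDiff_snd hkn, ← graphDiff_snd hkn, Real.norm_eq_abs, sub_zero] at hd
      have h2 := abs_add_le ((graphDiff k φ a (γ h)).2 - (graphDiff k φ a c).2)
        (graphDiff k φ a c).2
      rw [sub_add_cancel] at h2
      nlinarith [mul_nonneg (mul_nonneg (by linarith : (0 : ℝ) ≤ M) hh0) hS0]

theorem exists_norm_sub_lt_of_hdist_lt {n : ℕ} (a₀ : H n) {ρ : ℝ} (hρ : 0 < ρ) :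
    ∃ r > 0, ∀ a, hdist a₀ a < r → ‖a - a₀‖ < ρ := by
  set K := ∑ i, |a₀.1 i| with hK
  have hK0 : 0 ≤ K := Finset.sum_nonneg fun _ _ => abs_nonneg _
  have hpos : 0 < ρ / (K + 2) := by positivity
  refine ⟨min 1 (ρ / (K + 2)), by positivity, fun a ha => ?_⟩
  set r := min 1 (ρ / (K + 2)) with hr
  have hr1 : r ≤ 1 := min_le_left _ _
  have hrρ : r * (K + 2) ≤ ρ := (le_div_iff₀ (by positivity)).1 (min_le_right _ _)
  have hr0 : 0 < r := by positivity
  have hfst : (hmul (hinv a₀) a).1 = a.1 - a₀.1 := by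
    simp only [hmul, hinv]; abel
  have hsnd : (hmul (hinv a₀) a).2 = a.2 - a₀.2 + 1 / 2 * ∑ i : Fin n,
      (a₀.1 (hiIdx i) * (a.1 - a₀.1) (loIdx i) - a₀.1 (loIdx i) * (a.1 - a₀.1) (hiIdx i)) := by
    simp only [hmul, hinv, Pi.neg_apply, Pi.sub_apply]
    rw [neg_add_eq_sub]
    congr 2
    exact Finset.sum_congr rfl fun i _ => by ring
  rw [hdist, hnormH, hfst] at ha
  have hsq : 0 ≤ √|(hmul (hinv a₀) a).2| := Real.sqrt_nonneg _
  have hco : ∀ i, |(a.1 - a₀.1) i| < r := fun i => by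
    have := Finset.single_le_sum (f := fun i => |(a.1 - a₀.1) i|) (fun _ _ => abs_nonneg _)
      (Finset.mem_univ i)
    linarith
  have hs0 : 0 ≤ ∑ i, |(a.1 - a₀.1) i| := Finset.sum_nonneg fun _ _ => abs_nonneg _
  have hz : |(hmul (hinv a₀) a).2| < r := by
    have h1 : √|(hmul (hinv a₀) a).2| < r := by linarith
    rw [Real.sqrt_lt' hr0] at h1
    nlinarith
  have hrρ' : r < ρ := by nlinarith
  rw [Prod.norm_def, max_lt_iff]
  refine ⟨(pi_norm_lt_iff hρ).2 fun i => (hco i).trans hrρ', ?_⟩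
  have hlo : ∑ i : Fin n, |a₀.1 (loIdx i)| ≤ K := by
    have hinj : Function.Injective (loIdx (n := n)) := fun i i' h => by
      simpa [loIdx, Fin.ext_iff] using h
    refine (Finset.sum_map Finset.univ ⟨loIdx, hinj⟩ fun i => |a₀.1 i|).symm.trans_le ?_
    exact Finset.sum_le_sum_of_subset_of_nonneg (Finset.subset_univ _) fun _ _ _ => abs_nonneg _
  have hhi : ∑ i : Fin n, |a₀.1 (hiIdx i)| ≤ K := by
    have hinj : Function.Injective (hiIdx (n := n)) := fun i i' h => by
      simpa [hiIdx, Fin.ext_iff] using h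
    refine (Finset.sum_map Finset.univ ⟨hiIdx, hinj⟩ fun i => |a₀.1 i|).symm.trans_le ?_
    exact Finset.sum_le_sum_of_subset_of_nonneg (Finset.subset_univ _) fun _ _ _ => abs_nonneg _
  have hsum : |∑ i : Fin n, (a₀.1 (hiIdx i) * (a.1 - a₀.1) (loIdx i) -
      a₀.1 (loIdx i) * (a.1 - a₀.1) (hiIdx i))| ≤ 2 * K * r := by
    calc _ ≤ ∑ i : Fin n, (|a₀.1 (hiIdx i)| * r + |a₀.1 (loIdx i)| * r) := by
          refine (Finset.abs_sum_le_sum_abs _ _).trans (Finset.sum_le_sum fun i _ => ?_)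
          refine (abs_sub _ _).trans ?_
          rw [abs_mul, abs_mul]
          gcongr
          · exact (hco _).le
          · exact (hco _).le
      _ = (∑ i : Fin n, |a₀.1 (hiIdx i)| + ∑ i : Fin n, |a₀.1 (loIdx i)|) * r := by
          rw [Finset.sum_add_distrib, ← Finset.sum_mul, ← Finset.sum_mul, add_mul]
      _ ≤ 2 * K * r := by gcongr; linarith
  rw [hsnd, abs_lt] at hz
  rw [abs_le] at hsum
  rw [Prod.snd_sub, Real.norm_eq_abs, abs_lt]
  constructor <;> nlinarith [hz.1, hz.2, hsum.1, hsum.2]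

/-- In `H^n` (`n ≥ 2`, `1 ≤ k < n`), if `D^φφ = ω` in the broad* sense on
`U` for some continuous `ω`, then `φ` is uniformly intrinsically differentiable on `U` and
its intrinsic gradient satisfies `∇^φφ(a₀) = ω(a₀)` at every `a₀ ∈ U`. -/
theorem statement13 (n k : ℕ) (hn : 2 ≤ n) (hk : 1 ≤ k) (hkn : k < n)
    (U : Set (H n)) (hUW : U ⊆ WsetH n k) (hUopen : RelOpenH n k U)
    (φ : H n → Fin k → ℝ) (hφ : ContinuousOn φ U)
    (ω : H n → Fin k → Fin (2 * n) → ℝ)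
    (hω : ∀ l : Fin k, ∀ j : Fin (2 * n), k ≤ (j : ℕ) →
      ContinuousOn (fun w => ω w l j) U)
    (hbroad : IsBroadStarH n k U φ ω) :
    ∀ a₀ ∈ U, UIDAtH n k U φ a₀ (fun l j => ω a₀ l j) := by
  intro a₀ ha₀ ε hε
  obtain ⟨M, hM, hflow⟩ := exists_isControlledFlow hφ hω hbroad ha₀
  have hk0 : (0 : ℝ) < k := by exact_mod_cast hk
  set ε' := ε / (k * (1 + M)) with hε'
  have hε'0 : 0 < ε' := by positivity
  obtain ⟨ρ₁, hρ₁, hholder⟩ := exists_vertical_holder hkn hflow hε'0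
  obtain ⟨ρ₂, hρ₂, hflow⟩ := hflow ε' hε'0
  set ρ := min ρ₁ ρ₂ with hρ
  have hρ0 : 0 < ρ := by positivity
  obtain ⟨r, hr, hball⟩ := exists_norm_sub_lt_of_hdist_lt a₀
    (show 0 < ρ / (1 + M * (4 * n)) by positivity)
  refine ⟨r, hr, fun a ha b hb har hbr _ => ?_⟩
  change _ ≤ ε * hnormH (graphDiff k φ a b)
  have haρ := hball a har
  have hbρ := hball b hbr
  set ρ' := ρ / (1 + M * (4 * n)) with hρ'
  have hρ'ρ : ρ' * (1 + M * (4 * n)) = ρ := div_mul_cancel₀ _ (by positivity)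
  have hρ'0 : 0 < ρ' := by positivity
  have hn0 : (0 : ℝ) ≤ M * (4 * n) := by positivity
  have hsum : ∑ j, |b.1 j - a.1 j| ≤ 4 * n * ρ' := by
    have h1 : ∀ j, |b.1 j - a.1 j| ≤ 2 * ρ' := fun j => by
      have h1 := norm_sub_le_norm_sub_add_norm_sub b a₀ a
      rw [norm_sub_rev a₀] at h1
      have h2 := (norm_le_pi_norm (b - a).1 j).trans (norm_fst_le (b - a))
      simp only [Prod.fst_sub, Pi.sub_apply, Real.norm_eq_abs] at h2
      linarith
    refine (Finset.sum_le_sum fun j _ => h1 j).trans ?_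
    simp only [Finset.sum_const, Finset.card_univ, Fintype.card_fin, nsmul_eq_mul]
    push_cast
    linarith
  have hMsum : M * ∑ j, |b.1 j - a.1 j| ≤ M * (4 * n * ρ') :=
    mul_le_mul_of_nonneg_left hsum (by linarith)
  have hab : ‖a - a₀‖ + M * ∑ j, |b.1 j - a.1 j| < ρ := by
    rw [← hρ'ρ]; linarith
  obtain ⟨c, hcU, hc1, hca, hcA, -, hcV⟩ := exists_flow_chain hkn hUW hM hflow ha
    (hab.trans_le (min_le_right _ _)) (Finset.univ.filter fun j : Fin (2 * n) => k ≤ (j : ℕ))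
    (fun j hj => (Finset.mem_filter.1 hj).2)
  set S := ∑ j ∈ Finset.univ.filter (fun j : Fin (2 * n) => k ≤ (j : ℕ)), |b.1 j - a.1 j| with hS
  have hS0 : 0 ≤ S := Finset.sum_nonneg fun _ _ => abs_nonneg _
  have hS1 : S ≤ ∑ j, |b.1 j - a.1 j| :=
    Finset.sum_le_sum_of_subset_of_nonneg (Finset.subset_univ _) fun _ _ _ => abs_nonneg _
  have hcb : c.1 = b.1 := funext fun j => by
    rw [hc1 j]
    by_cases hj : k ≤ (j : ℕ)
    · simp [hj]
    · simp [hj, hUW ha j (not_le.1 hj), hUW hb j (not_le.1 hj)]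
  have hcρ : ‖c - a₀‖ < ρ := by
    have h1 := norm_sub_le_norm_sub_add_norm_sub c a a₀
    have h2 : M * S ≤ M * ∑ j, |b.1 j - a.1 j| := mul_le_mul_of_nonneg_left hS1 (by linarith)
    linarith
  have hbρ1 : ‖b - a₀‖ < ρ := by nlinarith
  have hh := hholder c hcU b hb (hcρ.trans_le (min_le_left _ _))
    (hbρ1.trans_le (min_le_left _ _)) hcb
  set V := (graphDiff k φ a b).2 with hV
  have hbc : b.2 - c.2 = V - (graphDiff k φ a c).2 := by
    simp only [hV, graphDiff_snd hkn, graphDiffLin, Prod.fst_sub, Prod.snd_sub, hcb]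
    ring
  have hsqrt : √|b.2 - c.2| ≤ √|V| + M * S := by
    rw [Real.sqrt_le_left (by positivity), hbc]
    have h1 := abs_sub V (graphDiff k φ a c).2
    have h2 := Real.sq_sqrt (abs_nonneg V)
    have h3 : M * S ^ 2 ≤ M * (M * S ^ 2) := le_mul_of_one_le_left (by positivity) hM
    have h4 : 0 ≤ √|V| * (M * S) := by positivity
    nlinarith
  have hnorm : hnormH (graphDiff k φ a b) = ∑ j, |b.1 j - a.1 j| + √|V| := by
    simp only [hnormH, graphDiff_fst, Pi.sub_apply, hV]
  set N := ∑ j, |b.1 j - a.1 j| + √|V| with hN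
  have hV0 : 0 ≤ √|V| := Real.sqrt_nonneg _
  have hl : ∀ l : Fin k, |φ b l - φ a l -
      ∑ j ∈ Finset.univ.filter (fun j : Fin (2 * n) => k ≤ (j : ℕ)),
        ω a₀ l j * (b.1 j - a.1 j)| ≤ ε' * (1 + M) * N := fun l => by
    have h1 := abs_add_le (φ b l - φ c l) (φ c l - φ a l -
      ∑ j ∈ Finset.univ.filter (fun j : Fin (2 * n) => k ≤ (j : ℕ)), ω a₀ l j * (b.1 j - a.1 j))
    rw [← add_sub_assoc, sub_add_sub_cancel] at h1
    have h2 : ε' * √|b.2 - c.2| ≤ ε' * (√|V| + M * S) := mul_le_mul_of_nonneg_left hsqrt hε'0.le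
    have h3 : ε' * (√|V| + M * S + S) ≤ ε' * ((1 + M) * N) := by
      refine mul_le_mul_of_nonneg_left ?_ hε'0.le
      nlinarith
    linarith [hcA l, hh l]
  rw [hnorm]
  calc _ ≤ ∑ l : Fin k, |φ b l - φ a l -
        ∑ j ∈ Finset.univ.filter (fun j : Fin (2 * n) => k ≤ (j : ℕ)),
          ω a₀ l j * (b.1 j - a.1 j)| := by
        rw [Real.sqrt_le_left (Finset.sum_nonneg fun _ _ => abs_nonneg _)]
        simp only [← sq_abs (_ - _ - _)]
        exact Finset.sum_sq_le_sq_sum_of_nonneg fun _ _ => abs_nonneg _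
    _ ≤ ∑ _l : Fin k, ε' * (1 + M) * N := Finset.sum_le_sum fun l _ => hl l
    _ = ε * N := by
        rw [Finset.sum_const, Finset.card_univ, Fintype.card_fin, nsmul_eq_mul, hε']
        field_simp

end Heis
end

section
/- Let V ⊆ W_F be open, ψ : V → ℝ continuous, and assume that D^ψψ = ω in the broad* sense on V for some continuous ω : V → ℝ^{m−1}. Then ψ is vertically broad* Hölder on V. -/
namespace Free

/-- The index set of the vertical coordinates `y_{ls}`, `1 ≤ s < l ≤ m`, of the free
step-2 group of rank `m`. -/
abbrev VIdx (m : ℕ) := {p : Fin m × Fin m // p.2 < p.1}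

/-- The underlying space of the free step-2 Carnot group of rank `m`. -/
abbrev F (m : ℕ) := (Fin m → ℝ) × (VIdx m → ℝ)

/-- The subgroup `W_F = {x_1 = 0}`. -/
def WsetF (m : ℕ) [NeZero m] : Set (F m) := {p | p.1 0 = 0}

/-- `V` is (relatively) open in `W_F`. -/
def RelOpenF (m : ℕ) [NeZero m] (V : Set (F m)) : Prop :=
  ∃ O : Set (F m), IsOpen O ∧ V = O ∩ WsetF m

/-- Euclidean distance on `F`. -/
noncomputable def eDistF {m : ℕ} (p q : F m) : ℝ :=
  Real.sqrt ((∑ j, (p.1 j - q.1 j) ^ 2) + ∑ ls : VIdx m, (p.2 ls - q.2 ls) ^ 2)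

/-- The projected vector field `D^ψ_j` on `W_F` (for `j ≠ 0`):
`D^ψ_j = ∂_{x_j} - ψ ∂_{y_{j1}} + (1/2)Σ_{j<l} x_l ∂_{y_{lj}} - (1/2)Σ_{1<s<j} x_s ∂_{y_{js}}`. -/
noncomputable def DvecF {m : ℕ} [NeZero m] (ψ : F m → ℝ) (j : Fin m) (w : F m) : F m :=
  ((fun j' => if j' = j then 1 else 0),
   fun ls =>
     if ls.1.1 = j ∧ ls.1.2 = 0 then -ψ w
     else if ls.1.2 = j then (1 / 2) * w.1 ls.1.1
     else if ls.1.1 = j then -(1 / 2) * w.1 ls.1.2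
     else 0)

/-- `D^ψψ = ω` in the broad* sense on `V ⊆ W_F`. -/
def IsBroadStarF {m : ℕ} [NeZero m] (V : Set (F m)) (ψ : F m → ℝ)
    (ω : F m → Fin m → ℝ) : Prop :=
  ∀ a₀ ∈ V, ∃ δ₁ δ₂ : ℝ, 0 < δ₂ ∧ δ₂ < δ₁ ∧
    ∀ j : Fin m, j ≠ 0 → ∃ E : F m → ℝ → F m,
      ∀ a, a ∈ V → eDistF a a₀ ≤ δ₂ →
        (∀ t ∈ Set.Icc (-δ₂) δ₂, E a t ∈ V ∧ eDistF (E a t) a₀ ≤ δ₁) ∧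
        E a 0 = a ∧
        (∀ t ∈ Set.Icc (-δ₂) δ₂,
          HasDerivWithinAt (E a) (DvecF ψ j (E a t)) (Set.Icc (-δ₂) δ₂) t) ∧
        (∀ t ∈ Set.Icc (-δ₂) δ₂, ψ (E a t) - ψ a = ∫ s in (0:ℝ)..t, ω (E a s) j)

/-- `ψ` is vertically broad* Hölder on `V ⊆ W_F`. -/
def VertHolderF (m : ℕ) [NeZero m] (V : Set (F m)) (ψ : F m → ℝ) : Prop :=
  ∀ a₀ ∈ V, ∃ V' : Set (F m), RelOpenF m V' ∧ a₀ ∈ V' ∧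
    IsCompact (closure V') ∧ closure V' ⊆ V ∧
    ∀ ls : VIdx m, ∀ ε > (0:ℝ), ∃ ρ > (0:ℝ), ∀ p ∈ V', ∀ q ∈ V',
      p.1 = q.1 → (∀ ls' : VIdx m, ls' ≠ ls → p.2 ls' = q.2 ls') →
      0 < |p.2 ls - q.2 ls| → |p.2 ls - q.2 ls| ≤ ρ →
      |ψ p - ψ q| ≤ ε * Real.sqrt |p.2 ls - q.2 ls|

end Free

namespace Free

open Set Metric

/-- A curve whose speed is below `C` as long as it stays within `R` of its starting point
moves at most `C * t` up to time `t ≤ R / C`. -/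
theorem norm_sub_le_of_local_deriv_bound_right {E : Type*} [NormedAddCommGroup E]
    [NormedSpace ℝ E] {γ γ' : ℝ → E} {T C R : ℝ}
    (hγ : ∀ t ∈ Icc 0 T, HasDerivWithinAt γ (γ' t) (Icc 0 T) t)
    (hb : ∀ t ∈ Icc 0 T, ‖γ t - γ 0‖ ≤ R → ‖γ' t‖ < C) (hC : 0 ≤ C) (hCT : C * T ≤ R) :
    ∀ t ∈ Icc 0 T, ‖γ t - γ 0‖ ≤ C * t := by
  have key := image_norm_le_of_norm_deriv_right_lt_deriv_boundary' (a := 0) (b := T)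
    (f := fun t => γ t - γ 0) (f' := γ') (B := fun t => C * t) (B' := fun _ => C)
    (fun t ht => ((hγ t ht).continuousWithinAt.sub continuousWithinAt_const))
    (fun t ht => by
      have h1 := (hγ t ⟨ht.1, ht.2.le⟩).sub_const (γ 0)
      exact (h1.mono_of_mem_nhdsWithin
        (mem_nhdsWithin.2 ⟨Iio T, isOpen_Iio, ht.2, fun s hs =>
          ⟨ht.1.trans hs.2, (mem_Iio.1 hs.1).le⟩⟩)))
    (by simp) (by fun_prop)
    (fun t _ => by simpa using ((hasDerivAt_id t).const_mul C).hasDerivWithinAt)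
    (fun t ht h => hb t ⟨ht.1, ht.2.le⟩
      (h.le.trans ((mul_le_mul_of_nonneg_left ht.2.le hC).trans hCT)))
  exact fun t ht => key ht

theorem norm_sub_le_of_local_deriv_bound {E : Type*} [NormedAddCommGroup E]
    [NormedSpace ℝ E] {γ γ' : ℝ → E} {T C R : ℝ}
    (hγ : ∀ t ∈ Icc (-T) T, HasDerivWithinAt γ (γ' t) (Icc (-T) T) t)
    (hb : ∀ t ∈ Icc (-T) T, ‖γ t - γ 0‖ ≤ R → ‖γ' t‖ < C) (hC : 0 ≤ C) (hCT : C * T ≤ R) :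
    ∀ t ∈ Icc (-T) T, ‖γ t - γ 0‖ ≤ C * |t| := by
  intro t ht
  have hT : 0 ≤ T := by linarith [ht.1, ht.2]
  rcases le_total 0 t with h | h
  · rw [abs_of_nonneg h]
    have hsub : Icc 0 T ⊆ Icc (-T) T := Icc_subset_Icc_left (by linarith)
    exact norm_sub_le_of_local_deriv_bound_right
      (fun s hs => (hγ s (hsub hs)).mono hsub) (fun s hs => hb s (hsub hs)) hC hCT t ⟨h, ht.2⟩
  · rw [abs_of_nonpos h]
    have hmaps : MapsTo (fun s : ℝ => -s) (Icc 0 T) (Icc (-T) T) :=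
      fun s hs => ⟨by linarith [hs.2], by linarith [hs.1]⟩
    have := norm_sub_le_of_local_deriv_bound_right (γ := fun s => γ (-s))
      (γ' := fun s => -γ' (-s)) (T := T) (C := C) (R := R)
      (fun s hs => by
        have h2 := (hγ (-s) (hmaps hs)).scomp s
          ((hasDerivAt_neg s).hasDerivWithinAt (s := Icc 0 T)) hmaps
        simpa [Function.comp_def] using h2)
      (fun s hs h2 => by
        rw [norm_neg]
        exact hb (-s) (hmaps hs) (by simpa using h2)) hC hCT (-t)
      ⟨by linarith, by linarith [ht.1]⟩
    simpa using this

/-- A function with derivative within `B` of `c` on a symmetric interval is within `B * |t|` of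
its linearisation at `0`. -/
theorem abs_sub_linear_le {f f' : ℝ → ℝ} {T B c : ℝ}
    (hf : ∀ t ∈ Icc (-T) T, HasDerivWithinAt f (f' t) (Icc (-T) T) t)
    (hB : ∀ t ∈ Icc (-T) T, |f' t - c| ≤ B) :
    ∀ t ∈ Icc (-T) T, |f t - f 0 - t * c| ≤ B * |t| := by
  intro t ht
  have h := Convex.norm_image_sub_le_of_norm_hasDerivWithin_le
    (f := fun s => f s - s * c) (f' := fun s => f' s - c) (C := B) (s := Icc (-T) T)
    (x := 0) (y := t)
    (fun s hs => by
      exact (hf s hs).sub (by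
        simpa using ((hasDerivAt_id s).mul_const c).hasDerivWithinAt (s := Icc (-T) T)))
    (fun s hs => hB s hs) (convex_Icc _ _)
    ⟨by linarith [ht.1, ht.2], by linarith [ht.1, ht.2]⟩ ht
  simp only [Real.norm_eq_abs, zero_mul, sub_zero] at h
  convert h using 2
  ring

theorem eq_add_mul_of_hasDerivWithinAt_const {f : ℝ → ℝ} {T c : ℝ}
    (hf : ∀ t ∈ Icc (-T) T, HasDerivWithinAt f c (Icc (-T) T) t) :
    ∀ t ∈ Icc (-T) T, f t = f 0 + t * c := by
  intro t ht
  have h := abs_sub_linear_le (B := 0) (c := c) hf (fun _ _ => by simp) t ht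
  rw [zero_mul] at h
  linarith [abs_eq_zero.1 (le_antisymm h (abs_nonneg _))]

theorem isClosed_WsetF (m : ℕ) [NeZero m] : IsClosed (WsetF m) := by
  have : Continuous fun p : F m => p.1 0 := by fun_prop
  exact isClosed_singleton.preimage this

theorem continuousOn_DvecF {m : ℕ} [NeZero m] {ψ : F m → ℝ} {K : Set (F m)}
    (hψ : ContinuousOn ψ K) (j : Fin m) : ContinuousOn (DvecF ψ j) K := by
  unfold DvecF
  refine continuousOn_const.prodMk (continuousOn_pi.2 fun k => ?_)
  split_ifs
  · exact hψ.neg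
  · fun_prop
  · fun_prop
  · fun_prop

theorem DvecF_snd_of_eq {m : ℕ} [NeZero m] (ψ : F m → ℝ) {j : Fin m} {k : VIdx m}
    (hk : k.1.1 = j ∧ k.1.2 = 0) (w : F m) : (DvecF ψ j w).2 k = -ψ w :=
  if_pos hk

/-- Curves `Φ j a` integrating the fields `D^ψ_j` from every `a` near `a₀`, uniformly Lipschitz in
time, along which `ψ` has a uniform first order expansion with coefficient `ω`. -/
structure UniformFlow {m : ℕ} [NeZero m] (ψ : F m → ℝ) (ω : F m → Fin m → ℝ) (a₀ : F m)
    (r C τ : ℝ) (Φ : Fin m → F m → ℝ → F m) : Prop where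
  r_pos : 0 < r
  one_le : 1 ≤ C
  τ_pos : 0 < τ
  zero : ∀ j ≠ 0, ∀ a ∈ closedBall a₀ r ∩ WsetF m, Φ j a 0 = a
  mem : ∀ j ≠ 0, ∀ a ∈ closedBall a₀ r ∩ WsetF m, ∀ t ∈ Icc (-τ) τ, Φ j a t ∈ WsetF m
  dist_le : ∀ j ≠ 0, ∀ a ∈ closedBall a₀ r ∩ WsetF m, ∀ t ∈ Icc (-τ) τ,
    dist (Φ j a t) a ≤ C * |t|
  deriv : ∀ j ≠ 0, ∀ a ∈ closedBall a₀ r ∩ WsetF m, ∀ t ∈ Icc (-τ) τ,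
    HasDerivWithinAt (Φ j a) (DvecF ψ j (Φ j a t)) (Icc (-τ) τ) t
  lip : ∀ j ≠ 0, ∀ a ∈ closedBall a₀ r ∩ WsetF m, ∀ t ∈ Icc (-τ) τ,
    |ψ (Φ j a t) - ψ a| ≤ C * |t|
  expand : ∀ β > 0, ∃ σ > 0, ∀ j ≠ 0, ∀ a ∈ closedBall a₀ r ∩ WsetF m, ∀ t ∈ Icc (-τ) τ,
    |t| ≤ σ → |ψ (Φ j a t) - ψ a - t * ω a j| ≤ β * |t|
  unif : ∀ β > 0, ∃ σ > 0, ∀ j ≠ 0, ∀ a ∈ closedBall a₀ r ∩ WsetF m,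
    ∀ b ∈ closedBall a₀ r ∩ WsetF m, dist a b ≤ σ → |ω a j - ω b j| ≤ β

theorem exists_uniformFlow {m : ℕ} [NeZero m] {V : Set (F m)} (hVopen : RelOpenF m V)
    {ψ : F m → ℝ} (hψ : ContinuousOn ψ V) {ω : F m → Fin m → ℝ}
    (hω : ∀ j : Fin m, j ≠ 0 → ContinuousOn (fun w => ω w j) V)
    (hbroad : IsBroadStarF V ψ ω) {a₀ : F m} (ha₀ : a₀ ∈ V) :
    ∃ r C τ Φ, UniformFlow ψ ω a₀ r C τ Φ ∧ closedBall a₀ r ∩ WsetF m ⊆ V := by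
  obtain ⟨O, hO, rfl⟩ := hVopen
  obtain ⟨δ₁, δ₂, hδ₂, -, hE⟩ := hbroad a₀ ha₀
  choose! Φ hΦ using hE
  have hcont : Continuous fun a : F m => eDistF a a₀ := by
    unfold eDistF
    fun_prop
  have hnhds : O ∩ {a | eDistF a a₀ < δ₂} ∈ nhds a₀ :=
    (hO.inter (isOpen_lt hcont continuous_const)).mem_nhds ⟨ha₀.1, by simp [eDistF, hδ₂]⟩
  obtain ⟨R, hR, hball⟩ := nhds_basis_closedBall.mem_iff.1 hnhds
  set K := closedBall a₀ R ∩ WsetF m with hK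
  have hKc : IsCompact K := (isCompact_closedBall a₀ R).inter_right (isClosed_WsetF m)
  have hKV : K ⊆ O ∩ WsetF m := fun a ha => ⟨(hball ha.1).1, ha.2⟩
  have hω' : ContinuousOn (fun w (j : Fin m) => if j = 0 then (0 : ℝ) else ω w j) K := by
    refine continuousOn_pi.2 fun j => ?_
    by_cases hj : j = 0
    · simp only [hj, if_true]
      exact continuousOn_const
    · simp only [hj, if_false]
      exact (hω j hj).mono hKV
  obtain ⟨C₁, hC₁⟩ := hKc.exists_bound_of_continuousOn hω'
  obtain ⟨C₂, hC₂⟩ := hKc.exists_bound_of_continuousOn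
    (continuousOn_pi.2 fun j => continuousOn_DvecF (hψ.mono hKV) j)
  have hunif := hKc.uniformContinuousOn_of_continuous hω'
  have hωsub : ∀ β > 0, ∃ σ > 0, ∀ j ≠ 0, ∀ a ∈ K, ∀ b ∈ K, dist a b ≤ σ →
      |ω a j - ω b j| ≤ β := by
    intro β hβ
    obtain ⟨σ, hσ, h⟩ := Metric.uniformContinuousOn_iff.1 hunif β hβ
    refine ⟨σ / 2, by positivity, fun j hj a ha b hb hab => ?_⟩
    have h1 := (dist_le_pi_dist _ _ j).trans (h a ha b hb (by linarith)).le
    simpa [hj, Real.dist_eq] using h1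
  have ha₀K : a₀ ∈ K := ⟨mem_closedBall_self hR.le, ha₀.2⟩
  have hC₁0 : 0 ≤ C₁ := (norm_nonneg _).trans (hC₁ a₀ ha₀K)
  have hC₂0 : 0 ≤ C₂ := (norm_nonneg _).trans (hC₂ a₀ ha₀K)
  set C := C₁ + C₂ + 1 with hC
  have hCpos : 0 < C := by positivity
  have hωC : ∀ j ≠ 0, ∀ a ∈ K, |ω a j| ≤ C := by
    intro j hj a ha
    have h1 := (norm_le_pi_norm _ j).trans (hC₁ a ha)
    simp only [hj, if_false, Real.norm_eq_abs] at h1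
    linarith
  have hDC : ∀ j, ∀ a ∈ K, ‖DvecF ψ j a‖ < C := by
    intro j a ha
    have h1 := (norm_le_pi_norm (fun j => DvecF ψ j a) j).trans (hC₂ a ha)
    linarith
  set τ := min δ₂ (R / 2 / C) with hτ
  have hτpos : 0 < τ := lt_min hδ₂ (by positivity)
  have hCτ : C * τ ≤ R / 2 := by
    calc C * τ ≤ C * (R / 2 / C) := mul_le_mul_of_nonneg_left (min_le_right _ _) hCpos.le
      _ = R / 2 := by field_simp
  have hsub : Icc (-τ) τ ⊆ Icc (-δ₂) δ₂ :=
    Icc_subset_Icc (neg_le_neg (min_le_left _ _)) (min_le_left _ _)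
  have hsmall : closedBall a₀ (R / 2) ∩ WsetF m ⊆ K :=
    inter_subset_inter_left _ (closedBall_subset_closedBall (by linarith))
  have hstart : ∀ a ∈ closedBall a₀ (R / 2) ∩ WsetF m,
      a ∈ O ∩ WsetF m ∧ eDistF a a₀ ≤ δ₂ := fun a ha =>
    ⟨hKV (hsmall ha), (hball (hsmall ha).1).2.le⟩
  have hder : ∀ j ≠ 0, ∀ a ∈ closedBall a₀ (R / 2) ∩ WsetF m, ∀ t ∈ Icc (-τ) τ,
      HasDerivWithinAt (Φ j a) (DvecF ψ j (Φ j a t)) (Icc (-τ) τ) t := by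
    intro j hj a ha t ht
    exact ((hΦ j hj a (hstart a ha).1 (hstart a ha).2).2.2.1 t (hsub ht)).mono hsub
  have hzero : ∀ j ≠ 0, ∀ a ∈ closedBall a₀ (R / 2) ∩ WsetF m, Φ j a 0 = a :=
    fun j hj a ha => (hΦ j hj a (hstart a ha).1 (hstart a ha).2).2.1
  have hW : ∀ j ≠ 0, ∀ a ∈ closedBall a₀ (R / 2) ∩ WsetF m, ∀ t ∈ Icc (-τ) τ,
      Φ j a t ∈ WsetF m := fun j hj a ha t ht =>
    ((hΦ j hj a (hstart a ha).1 (hstart a ha).2).1 t (hsub ht)).1.2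
  have hdist : ∀ j ≠ 0, ∀ a ∈ closedBall a₀ (R / 2) ∩ WsetF m, ∀ t ∈ Icc (-τ) τ,
      dist (Φ j a t) a ≤ C * |t| := by
    intro j hj a ha t ht
    have h0 := hzero j hj a ha
    have := norm_sub_le_of_local_deriv_bound (hder j hj a ha) (C := C) (R := R / 2)
      (fun s hs h => hDC j _ ⟨?_, hW j hj a ha s hs⟩) hCpos.le hCτ t ht
    · rwa [h0, ← dist_eq_norm] at this
    · rw [h0, ← dist_eq_norm] at h
      rw [mem_closedBall]
      linarith [dist_triangle (Φ j a s) a a₀, mem_closedBall.1 ha.1]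
  have hmemK : ∀ j ≠ 0, ∀ a ∈ closedBall a₀ (R / 2) ∩ WsetF m, ∀ t ∈ Icc (-τ) τ,
      Φ j a t ∈ K := by
    intro j hj a ha t ht
    refine ⟨?_, hW j hj a ha t ht⟩
    have h1 : C * |t| ≤ C * τ := mul_le_mul_of_nonneg_left (abs_le.2 ht) hCpos.le
    rw [mem_closedBall]
    linarith [dist_triangle (Φ j a t) a a₀, mem_closedBall.1 ha.1, hdist j hj a ha t ht]
  have hψint : ∀ j ≠ 0, ∀ a ∈ closedBall a₀ (R / 2) ∩ WsetF m, ∀ t ∈ Icc (-τ) τ,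
      ψ (Φ j a t) - ψ a = ∫ s in (0:ℝ)..t, ω (Φ j a s) j := fun j hj a ha t ht =>
    (hΦ j hj a (hstart a ha).1 (hstart a ha).2).2.2.2 t (hsub ht)
  have h0mem : (0 : ℝ) ∈ Icc (-τ) τ := ⟨by linarith, hτpos.le⟩
  refine ⟨R / 2, C, τ, Φ, ⟨by positivity, by linarith, hτpos, hzero, hW, hdist, hder, ?_, ?_, ?_⟩,
    hsmall.trans hKV⟩
  · intro j hj a ha t ht
    rw [hψint j hj a ha t ht]
    have := intervalIntegral.norm_integral_le_of_norm_le_const (a := 0) (b := t) (C := C)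
      (f := fun s => ω (Φ j a s) j) (fun s hs => by
        have hs' : s ∈ Icc (-τ) τ :=
          (ordConnected_Icc.uIcc_subset h0mem ht) (uIoc_subset_uIcc hs)
        exact hωC j hj _ (hmemK j hj a ha s hs'))
    simpa using this
  · intro β hβ
    obtain ⟨σ, hσ, h⟩ := hωsub β hβ
    refine ⟨σ / C, by positivity, fun j hj a ha t ht hts => ?_⟩
    have hut : uIcc 0 t ⊆ Icc (-τ) τ := ordConnected_Icc.uIcc_subset h0mem ht
    have hci : IntervalIntegrable (fun s => ω (Φ j a s) j) MeasureTheory.volume 0 t := by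
      refine ContinuousOn.intervalIntegrable ?_
      refine ((hω j hj).mono hKV).comp (t := K) (fun s hs =>
        (hder j hj a ha s (hut hs)).continuousWithinAt.mono hut) ?_
      exact fun s hs => hmemK j hj a ha s (hut hs)
    have heq : ψ (Φ j a t) - ψ a - t * ω a j = ∫ s in (0:ℝ)..t, (ω (Φ j a s) j - ω a j) := by
      rw [intervalIntegral.integral_sub hci (by simp), ← hψint j hj a ha t ht]
      simp
    rw [heq]
    have := intervalIntegral.norm_integral_le_of_norm_le_const (a := 0) (b := t) (C := β)
      (f := fun s => ω (Φ j a s) j - ω a j) (fun s hs => by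
        have hs' := hut (uIoc_subset_uIcc hs)
        refine h j hj _ (hmemK j hj a ha s hs') a (hsmall ha) ?_
        have h1 : |s| ≤ |t| := by
          have := abs_sub_left_of_mem_uIcc (uIoc_subset_uIcc hs)
          simpa using this
        calc dist (Φ j a s) a ≤ C * |s| := hdist j hj a ha s hs'
          _ ≤ C * (σ / C) := mul_le_mul_of_nonneg_left (h1.trans hts) hCpos.le
          _ = σ := by field_simp)
    simpa using this
  · intro β hβ
    obtain ⟨σ, hσ, h⟩ := hωsub β hβ
    exact ⟨σ, hσ, fun j hj a ha b hb => h j hj a (hsmall ha) b (hsmall hb)⟩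

namespace UniformFlow

variable {m : ℕ} [NeZero m] {ψ : F m → ℝ} {ω : F m → Fin m → ℝ} {a₀ : F m} {r C τ : ℝ}
  {Φ : Fin m → F m → ℝ → F m}

theorem hasDerivWithinAt_fst (h : UniformFlow ψ ω a₀ r C τ Φ) {j : Fin m} (hj : j ≠ 0) {a : F m}
    (ha : a ∈ closedBall a₀ r ∩ WsetF m) (i : Fin m) {t : ℝ} (ht : t ∈ Icc (-τ) τ) :
    HasDerivWithinAt (fun t => (Φ j a t).1 i) ((DvecF ψ j (Φ j a t)).1 i) (Icc (-τ) τ) t :=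
  hasDerivWithinAt_pi.1 (h.deriv j hj a ha t ht).fst i

theorem hasDerivWithinAt_snd (h : UniformFlow ψ ω a₀ r C τ Φ) {j : Fin m} (hj : j ≠ 0) {a : F m}
    (ha : a ∈ closedBall a₀ r ∩ WsetF m) (k : VIdx m) {t : ℝ} (ht : t ∈ Icc (-τ) τ) :
    HasDerivWithinAt (fun t => (Φ j a t).2 k) ((DvecF ψ j (Φ j a t)).2 k) (Icc (-τ) τ) t :=
  hasDerivWithinAt_pi.1 (h.deriv j hj a ha t ht).snd k

theorem fst_apply (h : UniformFlow ψ ω a₀ r C τ Φ) {j : Fin m} (hj : j ≠ 0) {a : F m}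
    (ha : a ∈ closedBall a₀ r ∩ WsetF m) (i : Fin m) {t : ℝ} (ht : t ∈ Icc (-τ) τ) :
    (Φ j a t).1 i = a.1 i + if i = j then t else 0 := by
  have := eq_add_mul_of_hasDerivWithinAt_const (c := if i = j then 1 else 0)
    (fun s hs => h.hasDerivWithinAt_fst hj ha i hs) t ht
  simpa [h.zero j hj a ha] using this

theorem snd_apply (h : UniformFlow ψ ω a₀ r C τ Φ) {j : Fin m} (hj : j ≠ 0) {a : F m}
    (ha : a ∈ closedBall a₀ r ∩ WsetF m) {k : VIdx m} (hk : ¬(k.1.1 = j ∧ k.1.2 = 0)) {t : ℝ}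
    (ht : t ∈ Icc (-τ) τ) :
    (Φ j a t).2 k = a.2 k + t * (if k.1.2 = j then (1 / 2) * a.1 k.1.1
      else if k.1.1 = j then -(1 / 2) * a.1 k.1.2 else 0) := by
  have hlt := k.2
  have := eq_add_mul_of_hasDerivWithinAt_const (f := fun t => (Φ j a t).2 k)
    (c := if k.1.2 = j then (1 / 2) * a.1 k.1.1
      else if k.1.1 = j then -(1 / 2) * a.1 k.1.2 else 0)
    (fun s hs => by
      convert h.hasDerivWithinAt_snd hj ha k hs using 1
      simp only [DvecF, hk, if_false]
      split_ifs with h1 h2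
      · rw [h.fst_apply hj ha _ hs, if_neg (by rintro rfl; exact hlt.ne h1)]
        ring
      · rw [h.fst_apply hj ha _ hs, if_neg h1]
        ring
      · rfl) t ht
  simpa [h.zero j hj a ha] using this

theorem abs_snd_sub_le (h : UniformFlow ψ ω a₀ r C τ Φ) {j : Fin m} (hj : j ≠ 0) {a : F m}
    (ha : a ∈ closedBall a₀ r ∩ WsetF m) {k : VIdx m} (hk : k.1.1 = j ∧ k.1.2 = 0) {t : ℝ}
    (ht : t ∈ Icc (-τ) τ) :
    |(Φ j a t).2 k - a.2 k + t * ψ a| ≤ C * |t| * |t| := by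
  have hsub : Icc (-|t|) |t| ⊆ Icc (-τ) τ :=
    Icc_subset_Icc (neg_le_neg (abs_le.2 ht)) (abs_le.2 ht)
  have := abs_sub_linear_le (f := fun t => (Φ j a t).2 k) (f' := fun t => -ψ (Φ j a t))
    (T := |t|) (B := C * |t|) (c := -ψ a)
    (fun s hs => by
      have := (h.hasDerivWithinAt_snd hj ha k (hsub hs)).mono hsub
      rwa [DvecF_snd_of_eq ψ hk] at this)
    (fun s hs => by
      rw [show -ψ (Φ j a s) - -ψ a = -(ψ (Φ j a s) - ψ a) by ring, abs_neg]
      exact (h.lip j hj a ha s (hsub hs)).trans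
        (mul_le_mul_of_nonneg_left (abs_le.2 hs) (by linarith [h.one_le])))
    t (abs_le.1 le_rfl)
  simpa [h.zero j hj a ha] using this

/-- Two points differing only in `y_{j1}` move in parallel along `D^ψ_j`. -/
theorem eq_of_snd_eq (h : UniformFlow ψ ω a₀ r C τ Φ) {j : Fin m} (hj : j ≠ 0) {p q : F m}
    (hp : p ∈ closedBall a₀ r ∩ WsetF m) (hq : q ∈ closedBall a₀ r ∩ WsetF m) {k : VIdx m}
    (hk : k.1.1 = j ∧ k.1.2 = 0) (h1 : p.1 = q.1) (h2 : ∀ k' ≠ k, p.2 k' = q.2 k') {t : ℝ}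
    (ht : t ∈ Icc (-τ) τ) (heq : (Φ j p t).2 k = (Φ j q t).2 k) : Φ j p t = Φ j q t := by
  refine Prod.ext (funext fun i => ?_) (funext fun k' => ?_)
  · rw [h.fst_apply hj hp i ht, h.fst_apply hj hq i ht, h1]
  · by_cases hkk : k' = k
    · rw [hkk, heq]
    · have hk' : ¬(k'.1.1 = j ∧ k'.1.2 = 0) := fun hc =>
        hkk (Subtype.ext (Prod.ext (hc.1.trans hk.1.symm) (hc.2.trans hk.2.symm)))
      rw [h.snd_apply hj hp hk' ht, h.snd_apply hj hq hk' ht, h1, h2 k' hkk]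

/-- Little Hölder continuity of exponent `1/2` in the directions `y_{l1}`. -/
theorem holder_first (h : UniformFlow ψ ω a₀ r C τ Φ) {ε : ℝ} (hε : 0 < ε) :
    ∃ ρ > 0, ∀ k : VIdx m, k.1.2 = 0 → ∀ p ∈ closedBall a₀ r ∩ WsetF m,
      ∀ q ∈ closedBall a₀ r ∩ WsetF m, p.1 = q.1 → (∀ k' ≠ k, p.2 k' = q.2 k') →
      |p.2 k - q.2 k| ≤ ρ → |ψ p - ψ q| ≤ ε * √|p.2 k - q.2 k| := by
  set β := ε ^ 2 / 12 with hβ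
  have hβpos : 0 < β := by positivity
  obtain ⟨σ₁, hσ₁, hexp⟩ := h.expand β hβpos
  obtain ⟨σ₂, hσ₂, hunif⟩ := h.unif β hβpos
  set T₀ := min σ₁ τ with hT₀
  have hT₀pos : 0 < T₀ := lt_min hσ₁ h.τ_pos
  refine ⟨min σ₂ ((ε * T₀ / 2) ^ 2), lt_min hσ₂ (by positivity), ?_⟩
  intro k hk0 p hp q hq h1 h2 hd
  have hj : k.1.1 ≠ 0 := fun hc => by
    have := k.2
    rw [hc, hk0] at this
    exact lt_irrefl _ this
  set j := k.1.1 with hjdef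
  set δ := |p.2 k - q.2 k| with hδ
  set u := √δ with hu
  have hu0 : 0 ≤ u := Real.sqrt_nonneg _
  have hu2 : u ^ 2 = δ := Real.sq_sqrt (abs_nonneg _)
  by_contra! hcon
  set T := 2 * u / ε with hT
  have hT0 : 0 ≤ T := by positivity
  have hTε : T * ε = 2 * u := by rw [hT]; field_simp
  have hTT₀ : T ≤ T₀ := by
    have : u ≤ ε * T₀ / 2 := by
      refine abs_le_of_sq_le_sq' ?_ (by positivity) |>.2
      rw [hu2]
      exact hd.trans (min_le_right _ _)
    rw [hT, div_le_iff₀ hε]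
    linarith
  have hTτ : T ≤ τ := hTT₀.trans (min_le_right _ _)
  have hTσ : T ≤ σ₁ := hTT₀.trans (min_le_left _ _)
  have hsub : Icc (-T) T ⊆ Icc (-τ) τ := Icc_subset_Icc (neg_le_neg hTτ) hTτ
  have hpq : dist p q ≤ σ₂ := by
    refine le_trans ?_ (hd.trans (min_le_left _ _))
    rw [Prod.dist_eq, h1, dist_self]
    refine max_le (abs_nonneg _) ((dist_pi_le_iff (abs_nonneg _)).2 fun k' => ?_)
    by_cases hkk : k' = k
    · rw [hkk, Real.dist_eq]
    · rw [h2 k' hkk, dist_self]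
      exact abs_nonneg _
  have hωpq : |ω p j - ω q j| ≤ β := hunif j hj p hp q hq hpq
  have hstep : ∀ t ∈ Icc (-T) T,
      |(ψ (Φ j p t) - ψ (Φ j q t)) - (ψ p - ψ q)| ≤ 3 * β * T := by
    intro t ht
    have htT : |t| ≤ T := abs_le.2 ht
    have e1 := hexp j hj p hp t (hsub ht) (htT.trans hTσ)
    have e2 := hexp j hj q hq t (hsub ht) (htT.trans hTσ)
    have e3 : |t * (ω p j - ω q j)| ≤ β * |t| := by
      rw [abs_mul, mul_comm]
      exact mul_le_mul_of_nonneg_right hωpq (abs_nonneg _)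
    have e4 : β * |t| ≤ β * T := mul_le_mul_of_nonneg_left htT hβpos.le
    rw [abs_le] at e1 e2 e3 ⊢
    constructor <;> linarith [e1.1, e1.2, e2.1, e2.2, e3.1, e3.2]
  have hβT : 3 * β * T = ε * u / 2 := by
    rw [hβ]
    linear_combination (ε / 4) * hTε
  have hne : ∀ t ∈ Icc (-T) T, (Φ j p t).2 k ≠ (Φ j q t).2 k := by
    intro t ht heq
    have := hstep t ht
    rw [h.eq_of_snd_eq hj hp hq ⟨rfl, hk0⟩ h1 h2 (hsub ht) heq, sub_self, zero_sub, abs_neg,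
      hβT] at this
    have := mul_nonneg hε.le hu0
    linarith
  set g : ℝ → ℝ := fun t => (Φ j p t).2 k - (Φ j q t).2 k with hg
  have hgder : ∀ t ∈ Icc (-T) T,
      HasDerivWithinAt g (-(ψ (Φ j p t) - ψ (Φ j q t))) (Icc (-T) T) t := by
    intro t ht
    have := ((h.hasDerivWithinAt_snd hj hp k (hsub ht)).sub
      (h.hasDerivWithinAt_snd hj hq k (hsub ht))).mono hsub
    rw [DvecF_snd_of_eq ψ ⟨rfl, hk0⟩, DvecF_snd_of_eq ψ ⟨rfl, hk0⟩,
      show ∀ x y : ℝ, -x - -y = -(x - y) by intros; ring] at this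
    exact this
  have hg0 : g 0 = p.2 k - q.2 k := by
    simp [hg, h.zero j hj p hp, h.zero j hj q hq]
  have hglin := abs_sub_linear_le (c := -(ψ p - ψ q)) (B := 3 * β * T) hgder (fun t ht => by
    rw [show -(ψ (Φ j p t) - ψ (Φ j q t)) - -(ψ p - ψ q)
      = -((ψ (Φ j p t) - ψ (Φ j q t)) - (ψ p - ψ q)) by ring, abs_neg]
    exact hstep t ht)
  have hgcont : ContinuousOn g (Icc (-T) T) := fun t ht => (hgder t ht).continuousWithinAt
  have hTmem : T ∈ Icc (-T) T := ⟨by linarith, le_rfl⟩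
  have hTmem' : -T ∈ Icc (-T) T := ⟨le_rfl, by linarith⟩
  have h0mem : (0 : ℝ) ∈ Icc (-T) T := ⟨by linarith, hT0⟩
  have hcross : ∀ t ∈ Icc (-T) T, 0 ∉ uIcc (g 0) (g t) := by
    intro t ht h0
    have hut : uIcc 0 t ⊆ Icc (-T) T := ordConnected_Icc.uIcc_subset h0mem ht
    obtain ⟨s, hs, hs0⟩ := intermediate_value_uIcc (hgcont.mono hut) h0
    exact hne s (hut hs) (sub_eq_zero.1 hs0)
  have hA := hglin T hTmem
  have hB := hglin (-T) hTmem'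
  rw [hβT, abs_neg, abs_of_nonneg hT0] at hB
  rw [hβT, abs_of_nonneg hT0] at hA
  have hTu : ε * u / 2 * T = δ := by
    rw [← hu2]
    linear_combination (u / 2) * hTε
  have hmain : 2 * δ ≤ T * |ψ p - ψ q| := by
    have := mul_le_mul_of_nonneg_left hcon.le hT0
    linarith
  rw [hTu, hg0, abs_le] at hA hB
  have hcA := hcross T hTmem
  have hcB := hcross (-T) hTmem'
  rw [mem_uIcc, hg0] at hcA hcB
  push Not at hcA hcB
  rcases abs_cases (p.2 k - q.2 k) with ⟨c1, c2⟩ | ⟨c1, c2⟩ <;>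
  rcases abs_cases (ψ p - ψ q) with ⟨d1, d2⟩ | ⟨d1, d2⟩ <;>
  rw [d1] at hmain <;> rw [← hδ] at c1
  · exact absurd (hcA.2 (by linarith [hA.2])) (by linarith)
  · exact absurd (hcB.2 (by linarith [hB.2])) (by linarith)
  · exact absurd (hcB.1 (by linarith)) (by linarith [hB.1])
  · exact absurd (hcA.1 (by linarith)) (by linarith [hA.1])

/-- The effect on the `y`-coordinates of the commutator path `D_s, D_l, -D_s, -D_l`. -/
theorem exists_commutator (h : UniformFlow ψ ω a₀ r C τ Φ) {k : VIdx m} (hs0 : k.1.2 ≠ 0)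
    {β : ℝ} (hβ : 0 < β) :
    ∃ σ > 0, ∀ p ∈ closedBall a₀ (r / 2) ∩ WsetF m, ∀ t ∈ Icc 0 σ,
      ∃ z ∈ closedBall a₀ r ∩ WsetF m, z.1 = p.1 ∧ z.2 k = p.2 k - t ^ 2 ∧
        (∀ k' : VIdx m, k'.1.2 ≠ 0 → k' ≠ k → z.2 k' = p.2 k') ∧
        (∀ k' : VIdx m, k'.1.2 = 0 → |z.2 k' - p.2 k'| ≤ 4 * C * t ^ 2) ∧
        (∀ k' : VIdx m, k'.1.2 = 0 → k'.1.1 ≠ k.1.1 → k'.1.1 ≠ k.1.2 → z.2 k' = p.2 k') ∧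
        |ψ z - ψ p| ≤ 6 * β * t := by
  have hC := h.one_le
  have hC0 : 0 < C := by linarith
  have hr := h.r_pos
  obtain ⟨σ₁, hσ₁, hexp⟩ := h.expand β hβ
  obtain ⟨σ₂, hσ₂, hunif⟩ := h.unif β hβ
  refine ⟨min (min τ (r / (8 * C))) (min σ₁ (σ₂ / (2 * C))),
    lt_min (lt_min h.τ_pos (by positivity)) (lt_min hσ₁ (by positivity)), ?_⟩
  rintro p ⟨hpb, hpW⟩ t ⟨ht0, ht⟩
  obtain ⟨⟨htτ, htr⟩, htσ₁, htσ₂⟩ : (t ≤ τ ∧ t ≤ r / (8 * C)) ∧ t ≤ σ₁ ∧ t ≤ σ₂ / (2 * C) := by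
    simpa only [le_min_iff] using ht
  rw [le_div_iff₀ (by positivity)] at htr htσ₂
  have hCt : 0 ≤ C * t := by positivity
  have hlt := k.2
  set l := k.1.1 with hl
  set s := k.1.2 with hs
  have hl0 : l ≠ 0 := ((Fin.pos_iff_ne_zero.2 hs0).trans hlt).ne'
  have hls : l ≠ s := hlt.ne'
  have tm : t ∈ Icc (-τ) τ := ⟨by linarith, htτ⟩
  have tm' : -t ∈ Icc (-τ) τ := ⟨by linarith, by linarith⟩
  have at' : |t| = t := abs_of_nonneg ht0
  have atn : |-t| = t := by rw [abs_neg, at']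
  rw [mem_closedBall] at hpb
  have hp : p ∈ closedBall a₀ r ∩ WsetF m := ⟨by rw [mem_closedBall]; linarith, hpW⟩
  set p₁ := Φ s p t with hp₁
  have d1 : dist p₁ p ≤ C * t := by simpa [at'] using h.dist_le s hs0 p hp t tm
  have m1 : p₁ ∈ closedBall a₀ r ∩ WsetF m :=
    ⟨by rw [mem_closedBall]; linarith [dist_triangle p₁ p a₀], h.mem s hs0 p hp t tm⟩
  set p₂ := Φ l p₁ t with hp₂
  have d2 : dist p₂ p₁ ≤ C * t := by simpa [at'] using h.dist_le l hl0 p₁ m1 t tm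
  have d2' : dist p₂ p ≤ 2 * (C * t) := by linarith [dist_triangle p₂ p₁ p]
  have m2 : p₂ ∈ closedBall a₀ r ∩ WsetF m :=
    ⟨by rw [mem_closedBall]; linarith [dist_triangle p₂ p a₀], h.mem l hl0 p₁ m1 t tm⟩
  set p₃ := Φ s p₂ (-t) with hp₃
  have d3 : dist p₃ p₂ ≤ C * t := by simpa [at'] using h.dist_le s hs0 p₂ m2 (-t) tm'
  have d3' : dist p₃ p₁ ≤ 2 * (C * t) := by linarith [dist_triangle p₃ p₂ p₁]
  have m3 : p₃ ∈ closedBall a₀ r ∩ WsetF m :=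
    ⟨by rw [mem_closedBall]; linarith [dist_triangle p₃ p₁ a₀, dist_triangle p₁ p a₀],
      h.mem s hs0 p₂ m2 (-t) tm'⟩
  set z := Φ l p₃ (-t) with hz
  have d4 : dist z p₃ ≤ C * t := by simpa [at'] using h.dist_le l hl0 p₃ m3 (-t) tm'
  have m4 : z ∈ closedBall a₀ r ∩ WsetF m :=
    ⟨by rw [mem_closedBall]
        linarith [dist_triangle z p₃ a₀, dist_triangle p₃ p₁ a₀, dist_triangle p₁ p a₀],
      h.mem l hl0 p₃ m3 (-t) tm'⟩
  have f1 := fun i => h.fst_apply hs0 hp i tm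
  have f2 := fun i => h.fst_apply hl0 m1 i tm
  have f3 := fun i => h.fst_apply hs0 m2 i tm'
  have f4 := fun i => h.fst_apply hl0 m3 i tm'
  rw [← hp₁] at f1
  rw [← hp₂] at f2
  rw [← hp₃] at f3
  rw [← hz] at f4
  have g1 := fun (k' : VIdx m) hk' => h.snd_apply (k := k') hs0 hp hk' tm
  have g2 := fun (k' : VIdx m) hk' => h.snd_apply (k := k') hl0 m1 hk' tm
  have g3 := fun (k' : VIdx m) hk' => h.snd_apply (k := k') hs0 m2 hk' tm'
  have g4 := fun (k' : VIdx m) hk' => h.snd_apply (k := k') hl0 m3 hk' tm'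
  rw [← hp₁] at g1
  rw [← hp₂] at g2
  rw [← hp₃] at g3
  rw [← hz] at g4
  have hvert : ∀ k' : VIdx m, k'.1.2 = 0 → k'.1.1 ≠ l → k'.1.1 ≠ s → z.2 k' = p.2 k' := by
    intro k' hk0 hkl hks
    rw [g4 k' (fun hc => hkl hc.1), g3 k' (fun hc => hks hc.1), g2 k' (fun hc => hkl hc.1),
      g1 k' (fun hc => hks hc.1)]
    simp [hk0, hkl, hks, hs0.symm, hl0.symm]
  have hlip : ∀ {x y w : ℝ}, |y - x| ≤ C * t → |w - y| ≤ C * t →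
      |t * (w - x)| ≤ 2 * (C * t * t) := by
    intro x y w hyx hwy
    rw [abs_mul, at']
    have : |w - x| ≤ 2 * (C * t) := by
      rw [abs_le] at *
      constructor <;> linarith [hyx.1, hyx.2, hwy.1, hwy.2]
    linarith [mul_le_mul_of_nonneg_left this ht0]
  have l1 : |ψ p₁ - ψ p| ≤ C * t := by simpa [at'] using h.lip s hs0 p hp t tm
  have l2 : |ψ p₂ - ψ p₁| ≤ C * t := by simpa [at'] using h.lip l hl0 p₁ m1 t tm
  have l3 : |ψ p₃ - ψ p₂| ≤ C * t := by simpa [at'] using h.lip s hs0 p₂ m2 (-t) tm'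
  refine ⟨z, m4, funext fun i => ?_, ?_, fun k' hk0 hk' => ?_, fun k' hk0 => ?_, hvert, ?_⟩
  · rw [f4, f3, f2, f1]
    split_ifs <;> ring
  · rw [g4 k (fun hc => hs0 hc.2), g3 k (fun hc => hs0 hc.2), g2 k (fun hc => hs0 hc.2),
      g1 k (fun hc => hs0 hc.2)]
    simp only [← hl, ← hs, f3, f2, f1, hls, hls.symm, if_true, if_false]
    ring
  · rw [g4 k' (fun hc => hk0 hc.2), g3 k' (fun hc => hk0 hc.2), g2 k' (fun hc => hk0 hc.2),
      g1 k' (fun hc => hk0 hc.2)]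
    have hlt' := k'.2
    have hne : ¬(k'.1.1 = l ∧ k'.1.2 = s) := fun hc => hk' (Subtype.ext (Prod.ext hc.1 hc.2))
    simp only [f3, f2, f1]
    split_ifs <;> first | ring1 | (exfalso; omega)
  · by_cases hkl : k'.1.1 = l
    · have hks : k'.1.1 ≠ s := fun hc => hls (hkl.symm.trans hc)
      have b1 := h.abs_snd_sub_le hl0 m1 ⟨hkl, hk0⟩ tm
      have b2 := h.abs_snd_sub_le hl0 m3 ⟨hkl, hk0⟩ tm'
      rw [← hp₂, g1 k' (fun hc => hks hc.1), at'] at b1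
      rw [← hz, g3 k' (fun hc => hks hc.1), atn] at b2
      simp only [hk0, hks, hs0.symm, if_false, mul_zero, add_zero] at b1 b2
      have b3 := hlip l2 l3
      rw [abs_le] at b1 b2 b3 ⊢
      constructor <;> linarith [b1.1, b1.2, b2.1, b2.2, b3.1, b3.2]
    · by_cases hks : k'.1.1 = s
      · have b1 := h.abs_snd_sub_le hs0 hp ⟨hks, hk0⟩ tm
        have b2 := h.abs_snd_sub_le hs0 m2 ⟨hks, hk0⟩ tm'
        rw [← hp₁, at'] at b1
        rw [← hp₃, g2 k' (fun hc => hkl hc.1), atn] at b2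
        rw [g4 k' (fun hc => hkl hc.1)]
        simp only [hk0, hkl, hl0.symm, if_false, mul_zero, add_zero] at b2 ⊢
        have b3 := hlip l1 l2
        rw [abs_le] at b1 b2 b3 ⊢
        constructor <;> linarith [b1.1, b1.2, b2.1, b2.2, b3.1, b3.2]
      · rw [hvert k' hk0 hkl hks, sub_self, abs_zero]
        positivity
  · have e1 := hexp s hs0 p hp t tm (by rwa [at'])
    have e2 := hexp l hl0 p₁ m1 t tm (by rwa [at'])
    have e3 := hexp s hs0 p₂ m2 (-t) tm' (by rwa [atn])
    have e4 := hexp l hl0 p₃ m3 (-t) tm' (by rwa [atn])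
    rw [← hp₁, at'] at e1
    rw [← hp₂, at'] at e2
    rw [← hp₃, atn] at e3
    rw [← hz, atn] at e4
    have hω : ∀ j ≠ 0, ∀ a ∈ closedBall a₀ r ∩ WsetF m, ∀ b ∈ closedBall a₀ r ∩ WsetF m,
        dist a b ≤ 2 * (C * t) → |t * (ω a j - ω b j)| ≤ β * t := by
      intro j hj a ha b hb hab
      rw [abs_mul, at', mul_comm]
      exact mul_le_mul_of_nonneg_right (hunif j hj a ha b hb (by linarith)) ht0
    have e5 := hω s hs0 p₂ m2 p hp d2'
    have e6 := hω l hl0 p₃ m3 p₁ m1 d3'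
    rw [abs_le] at e1 e2 e3 e4 e5 e6 ⊢
    constructor <;> linarith [e1.1, e1.2, e2.1, e2.2, e3.1, e3.2, e4.1, e4.2, e5.1, e5.2,
      e6.1, e6.2]

/-- Little Hölder continuity of exponent `1/2` in the directions `y_{ls}`, `s ≠ 1`. -/
theorem holder_second (h : UniformFlow ψ ω a₀ r C τ Φ) {k : VIdx m} (hs0 : k.1.2 ≠ 0) {ε : ℝ}
    (hε : 0 < ε) :
    ∃ ρ > 0, ∀ p ∈ closedBall a₀ (r / 2) ∩ WsetF m, ∀ q ∈ closedBall a₀ (r / 2) ∩ WsetF m,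
      p.1 = q.1 → (∀ k' ≠ k, p.2 k' = q.2 k') → |p.2 k - q.2 k| ≤ ρ →
      |ψ p - ψ q| ≤ ε * √|p.2 k - q.2 k| := by
  have hC := h.one_le
  have hC0 : 0 < C := by linarith
  obtain ⟨σ, hσ, hcomm⟩ := h.exists_commutator hs0 (β := ε / 12) (by positivity)
  obtain ⟨ρ, hρ, hfirst⟩ := h.holder_first (ε := ε / (8 * C)) (by positivity)
  refine ⟨min (σ ^ 2) (ρ / (4 * C)), lt_min (by positivity) (by positivity), ?_⟩
  intro p hp q hq h1 h2 hd
  wlog hle : q.2 k ≤ p.2 k generalizing p q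
  · rw [abs_sub_comm, abs_sub_comm (p.2 k)]
    exact this q hq p hp h1.symm (fun k' hk' => (h2 k' hk').symm)
      (by rwa [abs_sub_comm]) (le_of_not_ge hle)
  have hd0 : 0 ≤ p.2 k - q.2 k := by linarith
  rw [abs_of_nonneg hd0] at hd ⊢
  set t := √(p.2 k - q.2 k) with ht
  have ht0 : 0 ≤ t := Real.sqrt_nonneg _
  have ht2 : t ^ 2 = p.2 k - q.2 k := Real.sq_sqrt hd0
  have htσ : t ≤ σ := by
    refine (abs_le_of_sq_le_sq' ?_ hσ.le).2
    rw [ht2]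
    exact hd.trans (min_le_left _ _)
  have htρ : 4 * C * t ^ 2 ≤ ρ := by
    rw [ht2]
    have := hd.trans (min_le_right _ _)
    rw [le_div_iff₀ (by positivity)] at this
    linarith
  obtain ⟨z, hz, hz1, hzk, hzne, hz0, hz0', hψz⟩ := hcomm p hp t ⟨ht0, htσ⟩
  let kl : VIdx m := ⟨(k.1.1, 0), (Fin.pos_iff_ne_zero.2 hs0).trans k.2⟩
  let ks : VIdx m := ⟨(k.1.2, 0), Fin.pos_iff_ne_zero.2 hs0⟩
  have hkl : kl ≠ k := fun hc => hs0 (congrArg (fun x : VIdx m => x.1.2) hc).symm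
  have hks : ks ≠ k := fun hc => hs0 (congrArg (fun x : VIdx m => x.1.2) hc).symm
  have hlsne : kl ≠ ks := fun hc => k.2.ne' (congrArg (fun x : VIdx m => x.1.1) hc)
  let w : F m := (q.1, Function.update q.2 kl (z.2 kl))
  have hqr : q ∈ closedBall a₀ r ∩ WsetF m :=
    ⟨closedBall_subset_closedBall (by linarith [h.r_pos]) hq.1, hq.2⟩
  have hw : w ∈ closedBall a₀ r ∩ WsetF m := by
    refine ⟨?_, hq.2⟩
    have e1 := hqr.1
    have e2 := hz.1
    rw [mem_closedBall, Prod.dist_eq, max_le_iff] at e1 e2 ⊢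
    refine ⟨e1.1, (dist_pi_le_iff h.r_pos.le).2 fun k' => ?_⟩
    by_cases hk' : k' = kl
    · subst hk'
      simpa [w] using (dist_le_pi_dist z.2 a₀.2 kl).trans e2.2
    · simpa [w, hk'] using (dist_le_pi_dist q.2 a₀.2 k').trans e1.2
  have hzw : |z.2 ks - w.2 ks| ≤ 4 * C * t ^ 2 := by
    simpa [w, hlsne.symm, ← h2 ks hks] using hz0 ks rfl
  have hwq : |w.2 kl - q.2 kl| ≤ 4 * C * t ^ 2 := by
    simpa [w, ← h2 kl hkl] using hz0 kl rfl
  have hsqrt : ∀ x : ℝ, x ≤ 4 * C * t ^ 2 → √x ≤ 2 * C * t := by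
    intro x hx
    refine Real.sqrt_le_iff.2 ⟨by positivity, hx.trans ?_⟩
    nlinarith [mul_nonneg (mul_nonneg hC0.le (sub_nonneg.2 hC)) (sq_nonneg t)]
  have hεC : ε / (8 * C) * (2 * C * t) = ε / 4 * t := by
    field_simp
    ring
  have b1 : |ψ z - ψ w| ≤ ε / 4 * t := by
    refine (hfirst ks rfl z hz w hw (hz1.trans h1) (fun k' hk' => ?_) (hzw.trans htρ)).trans ?_
    · by_cases hk'l : k' = kl
      · simp [w, hk'l]
      · simp only [w, Function.update_of_ne hk'l]
        by_cases hk'k : k' = k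
        · rw [hk'k, hzk, ht2]
          ring
        · rw [← h2 k' hk'k]
          by_cases h0 : k'.1.2 = 0
          · exact hz0' k' h0
              (fun hc => hk'l (Subtype.ext (Prod.ext hc h0)))
              (fun hc => hk' (Subtype.ext (Prod.ext hc h0)))
          · exact hzne k' h0 hk'k
    · rw [← hεC]
      exact mul_le_mul_of_nonneg_left (hsqrt _ hzw) (by positivity)
  have b2 : |ψ w - ψ q| ≤ ε / 4 * t := by
    refine (hfirst kl rfl w hw q hqr rfl (fun k' hk' => ?_) (hwq.trans htρ)).trans ?_
    · simp [w, hk']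
    · rw [← hεC]
      exact mul_le_mul_of_nonneg_left (hsqrt _ hwq) (by positivity)
  rw [abs_le] at b1 b2 hψz ⊢
  constructor <;> linarith [b1.1, b1.2, b2.1, b2.2, hψz.1, hψz.2]

end UniformFlow

end Free

namespace Free

/-- In the free step-2 Carnot group of rank `m`, if `D^ψψ = ω` in the
broad* sense on `V` for some continuous `ω : V → ℝ^(m-1)`, then `ψ` is vertically broad*
Hölder on `V`. -/
theorem statement14 (m : ℕ) [NeZero m] (hm : 2 ≤ m)
    (V : Set (F m)) (hVW : V ⊆ WsetF m) (hVopen : RelOpenF m V)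
    (ψ : F m → ℝ) (hψ : ContinuousOn ψ V)
    (ω : F m → Fin m → ℝ)
    (hω : ∀ j : Fin m, j ≠ 0 → ContinuousOn (fun w => ω w j) V)
    (hbroad : IsBroadStarF V ψ ω) :
    VertHolderF m V ψ := by
  intro a₀ ha₀
  obtain ⟨r, C, τ, Φ, h, hV⟩ := exists_uniformFlow hVopen hψ hω hbroad ha₀
  have hr := h.r_pos
  have hsub : Metric.ball a₀ (r / 2) ∩ WsetF m ⊆ Metric.closedBall a₀ (r / 2) ∩ WsetF m :=
    Set.inter_subset_inter_left _ Metric.ball_subset_closedBall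
  have hsub' : Metric.closedBall a₀ (r / 2) ∩ WsetF m ⊆ Metric.closedBall a₀ r ∩ WsetF m :=
    Set.inter_subset_inter_left _ (Metric.closedBall_subset_closedBall (by linarith))
  have hcl : closure (Metric.ball a₀ (r / 2) ∩ WsetF m) ⊆
      Metric.closedBall a₀ (r / 2) ∩ WsetF m :=
    closure_minimal hsub (Metric.isClosed_closedBall.inter (isClosed_WsetF m))
  refine ⟨Metric.ball a₀ (r / 2) ∩ WsetF m, ⟨_, Metric.isOpen_ball, rfl⟩,
    ⟨Metric.mem_ball_self (by positivity), hVW ha₀⟩,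
    ((isCompact_closedBall a₀ (r / 2)).inter_right (isClosed_WsetF m)).of_isClosed_subset
      isClosed_closure hcl, hcl.trans (hsub'.trans hV), fun k ε hε => ?_⟩
  by_cases hk : k.1.2 = 0
  · obtain ⟨ρ, hρ, H⟩ := h.holder_first hε
    exact ⟨ρ, hρ, fun p hp q hq h1 h2 _ hd =>
      H k hk p (hsub' (hsub hp)) q (hsub' (hsub hq)) h1 h2 hd⟩
  · obtain ⟨ρ, hρ, H⟩ := h.holder_second hk hε
    exact ⟨ρ, hρ, fun p hp q hq h1 h2 _ hd => H p (hsub hp) q (hsub hq) h1 h2 hd⟩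

end Free
end

section
/- Suppose D^φφ = ω in the broad* sense on U for a continuous ω = (ω_2,…,ω_m) : U → ℝ^{m−1}. Then the lifted function ψ := φ∘π, defined on V := {w ∈ W_F : π(w) ∈ U}, satisfies D^ψψ = (ω_2∘π,…,ω_m∘π) in the broad* sense on V. -/
open MeasureTheory Filter Topology

namespace Step2

/-- The underlying space of the step-2 Carnot group `G = ℝ^m × ℝ^h`. -/
abbrev G (m h : ℕ) := (Fin m → ℝ) × (Fin h → ℝ)

variable {m h : ℕ}

/-- Group product `(x,y)·(x',y') = (x+x', y+y' - (1/2)⟨Bx,x'⟩)`. -/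
noncomputable def gmul (B : Fin h → Matrix (Fin m) (Fin m) ℝ) (p q : G m h) : G m h :=
  (p.1 + q.1, fun i => p.2 i + q.2 i - (1 / 2) * ∑ j, ∑ k, B i j k * p.1 k * q.1 j)

/-- Group inverse `g⁻¹ = -g`. -/
def ginv (p : G m h) : G m h := (-p.1, -p.2)

/-- Homogeneous norm `‖(x,y)‖ = Σ|x_j| + Σ|y_i|^(1/2)`. -/
noncomputable def hnorm (p : G m h) : ℝ :=
  (∑ j, |p.1 j|) + ∑ i, Real.sqrt |p.2 i|

/-- Homogeneous (quasi-)distance `d(p,q) = ‖p⁻¹·q‖`. -/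
noncomputable def gdist (B : Fin h → Matrix (Fin m) (Fin m) ℝ) (p q : G m h) : ℝ :=
  hnorm (gmul B (ginv p) q)

/-- Euclidean distance on `G`. -/
noncomputable def eDist (p q : G m h) : ℝ :=
  Real.sqrt ((∑ j, (p.1 j - q.1 j) ^ 2) + ∑ i, (p.2 i - q.2 i) ^ 2)

/-- The subgroup `W = {x_1 = 0}`. -/
def Wset (m h : ℕ) [NeZero m] : Set (G m h) := {p | p.1 0 = 0}

/-- `U` is (relatively) open in `W`. -/
def RelOpen (m h : ℕ) [NeZero m] (U : Set (G m h)) : Prop :=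
  ∃ O : Set (G m h), IsOpen O ∧ U = O ∩ Wset m h

/-- The graphing map `Φ(w) = (φ(w),0,…,0) ∈ L`. -/
noncomputable def Phi [NeZero m] (φ : G m h → ℝ) (w : G m h) : G m h :=
  ((fun j => if j = 0 then φ w else 0), 0)

/-- Horizontal coordinate vector `e_{x_j}`. -/
def eH (m h : ℕ) (j : Fin m) : G m h := ((fun j' => if j' = j then 1 else 0), 0)

/-- Vertical coordinate vector `e_{y_i}`. -/
def eV (m h : ℕ) (i : Fin h) : G m h := (0, fun i' => if i' = i then 1 else 0)

/-- The projected vector field `D^φ_j` (for `j ≠ 0`, i.e. `j = 2,…,m` in 1-based indexing):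
`D^φ_j|_w = ∂_{x_j} - Σ_i ( b^(i)_{j1} φ(w) + (1/2) Σ_{k≥2} x_k b^(i)_{jk} ) ∂_{y_i}`. -/
noncomputable def Dvec [NeZero m] (B : Fin h → Matrix (Fin m) (Fin m) ℝ)
    (φ : G m h → ℝ) (j : Fin m) (w : G m h) : G m h :=
  ((fun j' => if j' = j then 1 else 0),
   fun i => -(B i j 0 * φ w
      + (1 / 2) * ∑ k ∈ Finset.univ.erase (0 : Fin m), w.1 k * B i j k))

/-- `D^φφ = ω` in the broad* sense on `U`. -/
def IsBroadStar [NeZero m] (B : Fin h → Matrix (Fin m) (Fin m) ℝ) (U : Set (G m h))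
    (φ : G m h → ℝ) (ω : G m h → Fin m → ℝ) : Prop :=
  ∀ a₀ ∈ U, ∃ δ₁ δ₂ : ℝ, 0 < δ₂ ∧ δ₂ < δ₁ ∧
    ∀ j : Fin m, j ≠ 0 → ∃ E : G m h → ℝ → G m h,
      ∀ a, a ∈ U → eDist a a₀ ≤ δ₂ →
        (∀ t ∈ Set.Icc (-δ₂) δ₂, E a t ∈ U ∧ eDist (E a t) a₀ ≤ δ₁) ∧
        E a 0 = a ∧
        (∀ t ∈ Set.Icc (-δ₂) δ₂,
          HasDerivWithinAt (E a) (Dvec B φ j (E a t)) (Set.Icc (-δ₂) δ₂) t) ∧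
        (∀ t ∈ Set.Icc (-δ₂) δ₂, φ (E a t) - φ a = ∫ s in (0:ℝ)..t, ω (E a s) j)

/-- `φ` is vertically broad* Hölder on `U`. -/
def VertHolder (m h : ℕ) [NeZero m] (U : Set (G m h)) (φ : G m h → ℝ) : Prop :=
  ∀ a₀ ∈ U, ∃ U' : Set (G m h), RelOpen m h U' ∧ a₀ ∈ U' ∧
    IsCompact (closure U') ∧ closure U' ⊆ U ∧
    ∀ i : Fin h, ∀ ε > (0:ℝ), ∃ ρ > (0:ℝ), ∀ p ∈ U', ∀ q ∈ U',
      p.1 = q.1 → (∀ i' : Fin h, i' ≠ i → p.2 i' = q.2 i') →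
      0 < |p.2 i - q.2 i| → |p.2 i - q.2 i| ≤ ρ →
      |φ p - φ q| ≤ ε * Real.sqrt |p.2 i - q.2 i|

/-- The translated point `Φ(a)⁻¹·a⁻¹·b·Φ(a)`. -/
noncomputable def shiftQ [NeZero m] (B : Fin h → Matrix (Fin m) (Fin m) ℝ)
    (φ : G m h → ℝ) (a b : G m h) : G m h :=
  gmul B (gmul B (gmul B (ginv (Phi φ a)) (ginv a)) b) (Phi φ a)

/-- `φ` is intrinsically differentiable at `a₀` with intrinsic gradient `grad`. -/
def IDAt [NeZero m] (B : Fin h → Matrix (Fin m) (Fin m) ℝ) (U : Set (G m h))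
    (φ : G m h → ℝ) (a₀ : G m h) (grad : Fin m → ℝ) : Prop :=
  ∀ ε > (0:ℝ), ∃ r > (0:ℝ), ∀ b ∈ U, 0 < gdist B a₀ b → gdist B a₀ b < r →
    |φ b - φ a₀ - ∑ j ∈ Finset.univ.erase (0 : Fin m), grad j * (b.1 j - a₀.1 j)|
      ≤ ε * hnorm (shiftQ B φ a₀ b)

/-- `φ` is uniformly intrinsically differentiable at `a₀` with intrinsic gradient `grad`. -/
def UIDAt [NeZero m] (B : Fin h → Matrix (Fin m) (Fin m) ℝ) (U : Set (G m h))
    (φ : G m h → ℝ) (a₀ : G m h) (grad : Fin m → ℝ) : Prop :=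
  ∀ ε > (0:ℝ), ∃ r > (0:ℝ), ∀ a ∈ U, ∀ b ∈ U,
    gdist B a₀ a < r → gdist B a₀ b < r → a ≠ b →
    |φ b - φ a - ∑ j ∈ Finset.univ.erase (0 : Fin m), grad j * (b.1 j - a.1 j)|
      ≤ ε * hnorm (shiftQ B φ a b)

/-- Projection onto `L` in the splitting `G = W·L`. -/
def piL (m h : ℕ) [NeZero m] (g : G m h) : G m h :=
  ((fun j => if j = 0 then g.1 0 else 0), 0)

/-- Projection onto `W` in the splitting `G = W·L`. -/
noncomputable def piW [NeZero m] (B : Fin h → Matrix (Fin m) (Fin m) ℝ) (g : G m h) : G m h :=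
  ((fun j => if j = 0 then 0 else g.1 j),
   fun i => g.2 i + (1 / 2) * g.1 0 * ∑ k ∈ Finset.univ.erase (0 : Fin m), B i 0 k * g.1 k)

/-- Coordinates `ℝ^(m-1) × ℝ^h → W ⊆ G`. -/
def emb (m h : ℕ) (u : (Fin (m - 1) → ℝ) × (Fin h → ℝ)) : G m h :=
  ((fun j => if hj : (j : ℕ) = 0 then 0
      else u.1 ⟨(j : ℕ) - 1, by have := j.isLt; omega⟩), u.2)

/-- The Lebesgue measure on `W`, as a measure on `G`. -/
noncomputable def muW (m h : ℕ) : Measure (G m h) :=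
  Measure.map (emb m h) volume

end Step2

namespace Lift

/-- The lifting homomorphism `π : F → G`, `π(x,y) = (x, y*)` with
`y*_i = Σ_{1≤s<l≤m} b^(i)_{ls} y_{ls}`. -/
noncomputable def piFG {m h : ℕ} (B : Fin h → Matrix (Fin m) (Fin m) ℝ)
    (p : Free.F m) : Step2.G m h :=
  (p.1, fun i => ∑ ls : Free.VIdx m, B i ls.1.1 ls.1.2 * p.2 ls)

end Lift

open Lift

/-- The projected vector field `D^ψ_j` of a lifted function `ψ = φ ∘ π`, as a function of the
base point `π(w)` only. -/
noncomputable def liftVec {m h : ℕ} [NeZero m] (φ : Step2.G m h → ℝ) (j : Fin m)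
    (z : Step2.G m h) : Free.F m :=
  ((fun j' => if j' = j then 1 else 0),
   fun ls =>
     if ls.1.1 = j ∧ ls.1.2 = 0 then -φ z
     else if ls.1.2 = j then (1 / 2) * z.1 ls.1.1
     else if ls.1.1 = j then -(1 / 2) * z.1 ls.1.2
     else 0)

/-- The lifting homomorphism `π` as a continuous linear map. -/
noncomputable def piFGL {m h : ℕ} (B : Fin h → Matrix (Fin m) (Fin m) ℝ) :
    Free.F m →L[ℝ] Step2.G m h :=
  LinearMap.toContinuousLinearMap
    { toFun := piFG B
      map_add' := fun p q => by
        ext i <;> simp [piFG, mul_add, Finset.sum_add_distrib]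
      map_smul' := fun c p => by
        ext i <;> simp [piFG, Finset.mul_sum, mul_left_comm] }

theorem piFGL_apply {m h : ℕ} (B : Fin h → Matrix (Fin m) (Fin m) ℝ) (p : Free.F m) :
    piFGL B p = piFG B p := rfl

/-- The differential of `π` maps `D^ψ_j` to `D^φ_j`. -/
theorem piFG_liftVec {m h : ℕ} [NeZero m] {B : Fin h → Matrix (Fin m) (Fin m) ℝ}
    (hskew : ∀ i, (B i).transpose = - B i) (φ : Step2.G m h → ℝ) {j : Fin m} (hj : j ≠ 0)
    (z : Step2.G m h) : piFG B (liftVec φ j z) = Step2.Dvec B φ j z := by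
  have hB : ∀ i k l, B i k l = - B i l k := fun i k l => by
    simpa using congrFun (congrFun (hskew i) l) k
  have hBd : ∀ i k, B i k k = 0 := fun i k => by linarith [hB i k k]
  have hj0 : 0 < j := Fin.pos_iff_ne_zero.2 hj
  refine Prod.ext rfl (funext fun i => ?_)
  let g : Fin m × Fin m → ℝ := fun p => B i p.1 p.2 *
    (if p.1 = j ∧ p.2 = 0 then -φ z
     else if p.2 = j then (1 / 2) * z.1 p.1
     else if p.1 = j then -(1 / 2) * z.1 p.2
     else 0)
  have h1 : (piFG B (liftVec φ j z)).2 i = ∑ p : Fin m × Fin m, if p.2 < p.1 then g p else 0 := by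
    rw [← Finset.sum_filter]
    exact (Finset.sum_subtype _ (by simp) g).symm
  have h2 : ∀ p : Fin m × Fin m, (if p.2 < p.1 then g p else 0) =
      (if p.1 = j then
        (if p.2 < j then B i j p.2 * (if p.2 = 0 then -φ z else -(1 / 2) * z.1 p.2) else 0)
        else 0) +
      (if p.2 = j then (if j < p.1 then B i p.1 j * ((1 / 2) * z.1 p.1) else 0) else 0) := by
    rintro ⟨l, s⟩
    simp only [g]
    by_cases hl : l = j
    · subst hl
      by_cases hs : s = l
      · subst hs
        simp
      · by_cases hs0 : s = 0 <;> simp [hs, hs0]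
    · by_cases hs : s = j
      · subst hs
        simp [hl]
      · simp [hl, hs]
  have h3 : ∀ k : Fin m,
      (if k < j then B i j k * (if k = 0 then -φ z else -(1 / 2) * z.1 k) else 0) +
        (if j < k then B i k j * ((1 / 2) * z.1 k) else 0) =
      (if k = 0 then -(B i j 0 * φ z) else 0) +
        (if k ≠ 0 then -(1 / 2) * (z.1 k * B i j k) else 0) := by
    intro k
    by_cases hk : k = 0
    · subst hk
      simp [hj0, hj0.le]
    · rcases lt_trichotomy k j with hkj | hkj | hkj
      · simp [hk, hkj, hkj.not_gt]
        ring
      · subst hkj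
        simp [hk, hBd]
      · rw [hB i k j]
        simp [hk, hkj, hkj.not_gt]
        ring
  rw [h1, Finset.sum_congr rfl (fun p _ => h2 p), Finset.sum_add_distrib, Fintype.sum_prod_type,
    Fintype.sum_prod_type_right]
  have h4 : ∀ f : Fin m → ℝ, (∑ x : Fin m, ∑ y : Fin m, if x = j then f y else 0) = ∑ y, f y := by
    intro f
    rw [Finset.sum_comm]
    simp
  simp only [h4]
  rw [← Finset.sum_add_distrib, Finset.sum_congr rfl (fun k _ => h3 k), Finset.sum_add_distrib,
    ← Finset.sum_filter (fun k : Fin m => k ≠ 0), Finset.filter_ne', ← Finset.mul_sum]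
  simp [Step2.Dvec]
  ring

theorem continuousOn_liftVec {m h : ℕ} [NeZero m] {U : Set (Step2.G m h)}
    {φ : Step2.G m h → ℝ} (hφ : ContinuousOn φ U) (j : Fin m) :
    ContinuousOn (liftVec φ j) U := by
  refine ContinuousOn.prodMk continuousOn_const (continuousOn_pi.2 fun ls => ?_)
  split_ifs
  · exact hφ.neg
  · fun_prop
  · fun_prop
  · fun_prop

theorem norm_sub_le_eDistF {m : ℕ} (p q : Free.F m) : ‖p - q‖ ≤ Free.eDistF p q := by
  have hx : 0 ≤ ∑ j, (p.1 j - q.1 j) ^ 2 := Finset.sum_nonneg fun _ _ => sq_nonneg _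
  have hy : 0 ≤ ∑ ls : Free.VIdx m, (p.2 ls - q.2 ls) ^ 2 :=
    Finset.sum_nonneg fun _ _ => sq_nonneg _
  refine max_le ((pi_norm_le_iff_of_nonneg (Real.sqrt_nonneg _)).2 fun k => ?_)
    ((pi_norm_le_iff_of_nonneg (Real.sqrt_nonneg _)).2 fun k => ?_)
  · refine Real.le_sqrt_of_sq_le ?_
    have := Finset.single_le_sum (f := fun j => (p.1 j - q.1 j) ^ 2)
      (fun _ _ => sq_nonneg _) (Finset.mem_univ k)
    simp only [Prod.fst_sub, Pi.sub_apply, Real.norm_eq_abs, sq_abs]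
    linarith
  · refine Real.le_sqrt_of_sq_le ?_
    have := Finset.single_le_sum (f := fun ls => (p.2 ls - q.2 ls) ^ 2)
      (fun _ _ => sq_nonneg _) (Finset.mem_univ k)
    simp only [Prod.snd_sub, Pi.sub_apply, Real.norm_eq_abs, sq_abs]
    linarith

/-- A curve whose speed is less than `K` as long as it stays `K * δ`-close to its starting point
satisfies `‖γ t - γ 0‖ ≤ K * t` on `[0, δ]`. -/
theorem norm_sub_le_of_speed_lt_near {X : Type*} [NormedAddCommGroup X] [NormedSpace ℝ X]
    {γ γ' : ℝ → X} {δ K : ℝ} (hK : 0 ≤ K)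
    (hγ : ∀ t ∈ Set.Icc 0 δ, HasDerivWithinAt γ (γ' t) (Set.Icc 0 δ) t)
    (hb : ∀ t ∈ Set.Icc 0 δ, ‖γ t - γ 0‖ ≤ K * δ → ‖γ' t‖ < K) :
    ∀ t ∈ Set.Icc 0 δ, ‖γ t - γ 0‖ ≤ K * t := by
  have hf : ∀ t ∈ Set.Icc 0 δ,
      HasDerivWithinAt (fun t => γ t - γ 0) (γ' t) (Set.Icc 0 δ) t :=
    fun t ht => (hγ t ht).sub_const _
  intro t ht
  refine image_norm_le_of_norm_deriv_right_lt_deriv_boundary (f := fun t => γ t - γ 0)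
    (f' := γ') (B := fun t => K * t) (B' := fun _ => K)
    (fun s hs => (hf s hs).continuousWithinAt) (fun s hs => ?_) (by simp)
    (fun s => by simpa using (hasDerivAt_id s).const_mul K) (fun s hs hsK => ?_) ht
  · exact (hf s ⟨hs.1, hs.2.le⟩).mono_of_mem_nhdsWithin (Icc_mem_nhdsGE_of_mem hs)
  · refine hb s ⟨hs.1, hs.2.le⟩ ?_
    rw [hsK]
    exact mul_le_mul_of_nonneg_left hs.2.le hK

/-- Two-sided version of `norm_sub_le_of_speed_lt_near`. -/
theorem norm_sub_le_of_speed_lt_near_symm {X : Type*} [NormedAddCommGroup X] [NormedSpace ℝ X]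
    {γ γ' : ℝ → X} {δ K : ℝ} (hK : 0 ≤ K)
    (hγ : ∀ t ∈ Set.Icc (-δ) δ, HasDerivWithinAt γ (γ' t) (Set.Icc (-δ) δ) t)
    (hb : ∀ t ∈ Set.Icc (-δ) δ, ‖γ t - γ 0‖ ≤ K * δ → ‖γ' t‖ < K) :
    ∀ t ∈ Set.Icc (-δ) δ, ‖γ t - γ 0‖ ≤ K * δ := by
  intro t ht
  have hδ : 0 ≤ δ := by linarith [ht.1, ht.2]
  have hpos : ∀ s ∈ Set.Icc 0 δ, s ∈ Set.Icc (-δ) δ := fun s hs => ⟨by linarith [hs.1], hs.2⟩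
  have hneg : ∀ s ∈ Set.Icc 0 δ, -s ∈ Set.Icc (-δ) δ :=
    fun s hs => ⟨by linarith [hs.2], by linarith [hs.1]⟩
  rcases le_total 0 t with h0 | h0
  · refine (norm_sub_le_of_speed_lt_near (γ' := γ') (δ := δ) hK
      (fun s hs => (hγ s (hpos s hs)).mono hpos)
      (fun s hs => hb s (hpos s hs)) t ⟨h0, ht.2⟩).trans ?_
    exact mul_le_mul_of_nonneg_left ht.2 hK
  · have := norm_sub_le_of_speed_lt_near (γ := fun s => γ (-s)) (γ' := fun s => -γ' (-s))
      (δ := δ) hK (fun s hs => ?_) (fun s hs h => ?_) (-t) ⟨by linarith, by linarith [ht.1]⟩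
    · simp only [neg_neg, neg_zero] at this
      exact this.trans (mul_le_mul_of_nonneg_left (by linarith [ht.1]) hK)
    · have := (hγ (-s) (hneg s hs)).scomp s
        ((hasDerivAt_neg s).hasDerivWithinAt (s := Set.Icc 0 δ)) hneg
      simpa [Function.comp_def] using this
    · rw [norm_neg]
      exact hb (-s) (hneg s hs) (by simpa using h)

/-- Two curves on `[-δ, δ]` with equal derivatives and equal values at `0` coincide. -/
theorem eqOn_of_hasDerivWithinAt_eq {X : Type*} [NormedAddCommGroup X] [NormedSpace ℝ X]
    {f g f' : ℝ → X} {δ : ℝ}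
    (hf : ∀ t ∈ Set.Icc (-δ) δ, HasDerivWithinAt f (f' t) (Set.Icc (-δ) δ) t)
    (hg : ∀ t ∈ Set.Icc (-δ) δ, HasDerivWithinAt g (f' t) (Set.Icc (-δ) δ) t)
    (h0 : f 0 = g 0) : ∀ t ∈ Set.Icc (-δ) δ, f t = g t := by
  intro t ht
  have h := (convex_Icc (-δ) δ).norm_image_sub_le_of_norm_hasDerivWithin_le (C := 0)
    (f := fun t => f t - g t) (f' := fun _ => 0) (x := 0) (y := t)
    (fun s hs => by simpa only [sub_self] using (hf s hs).fun_sub (hg s hs)) (by simp)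
    ⟨by linarith [ht.1, ht.2], by linarith [ht.1, ht.2]⟩ ht
  simpa [h0, sub_eq_zero] using h

/-- A continuous curve `v` on `[-δ, δ]` has a primitive starting at a prescribed point. -/
theorem exists_primitive_Icc {X : Type*} [NormedAddCommGroup X] [NormedSpace ℝ X]
    [CompleteSpace X] {v : ℝ → X} {δ : ℝ} (hδ : 0 ≤ δ)
    (hv : ContinuousOn v (Set.Icc (-δ) δ)) (a : X) :
    ∃ γ : ℝ → X, γ 0 = a ∧
      ∀ t ∈ Set.Icc (-δ) δ, HasDerivWithinAt γ (v t) (Set.Icc (-δ) δ) t := by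
  have hle : -δ ≤ δ := by linarith
  have hc : Continuous (Set.IccExtend hle ((Set.Icc (-δ) δ).domRestrict v)) :=
    (continuousOn_iff_continuous_domRestrict.1 hv).Icc_extend'
  refine ⟨fun t => a + ∫ s in (0:ℝ)..t, Set.IccExtend hle ((Set.Icc (-δ) δ).domRestrict v) s,
    by simp, fun t ht => ?_⟩
  have := (hc.integral_hasStrictDerivAt 0 t).hasDerivAt.const_add a
  rw [Set.IccExtend_of_mem hle _ ht] at this
  exact this.hasDerivWithinAt


/-- If `D^φφ = ω` in the broad* sense on `U ⊆ W ⊆ G`, then the lifted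
function `ψ := φ∘π` on `V := π⁻¹(U) ⊆ W_F ⊆ F` satisfies `D^ψψ = ω∘π` in the broad* sense
on `V`. -/
theorem statement15 (m h : ℕ) [NeZero m] (hm : 2 ≤ m) (hh : 1 ≤ h)
    (B : Fin h → Matrix (Fin m) (Fin m) ℝ)
    (hskew : ∀ i, (B i).transpose = - B i) (hBli : LinearIndependent ℝ B)
    (U : Set (Step2.G m h)) (hUW : U ⊆ Step2.Wset m h) (hUopen : Step2.RelOpen m h U)
    (φ : Step2.G m h → ℝ) (hφ : ContinuousOn φ U)
    (ω : Step2.G m h → Fin m → ℝ)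
    (hω : ∀ j : Fin m, j ≠ 0 → ContinuousOn (fun w => ω w j) U)
    (hbroad : Step2.IsBroadStar B U φ ω) :
    Free.IsBroadStarF (piFG B ⁻¹' U) (fun w => φ (piFG B w))
      (fun w j => ω (piFG B w) j) := by
  intro a₀ ha₀
  obtain ⟨δ₁, δ₂, hδ₂, -, hE⟩ := hbroad (piFG B a₀) ha₀
  have hπ : Continuous (piFG B) := (piFGL B).continuous
  set K : ℝ := ‖fun j => liftVec φ j (piFG B a₀)‖ + 1 with hKdef
  have hKpos : 0 < K := by positivity
  have hvel : ∀ᶠ z in 𝓝 a₀, piFG B z ∈ U → ‖fun j => liftVec φ j (piFG B z)‖ < K := by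
    have hc : ContinuousOn (fun z j => liftVec φ j (piFG B z)) (piFG B ⁻¹' U) :=
      continuousOn_pi.2 fun j =>
        (continuousOn_liftVec hφ j).comp hπ.continuousOn (fun _ hz => hz)
    exact eventually_nhdsWithin_iff.1 ((hc a₀ ha₀).norm.eventually_lt_const (lt_add_one _))
  have hdG : ∀ᶠ z in 𝓝 a₀, Step2.eDist (piFG B z) (piFG B a₀) < δ₂ := by
    have hc : Continuous fun z => Step2.eDist (piFG B z) (piFG B a₀) := by
      unfold Step2.eDist
      fun_prop
    exact hc.continuousAt.eventually_lt_const (by simpa [Step2.eDist] using hδ₂)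
  have hdF : ∀ᶠ z in 𝓝 a₀, Free.eDistF z a₀ < 1 := by
    have hc : Continuous fun z => Free.eDistF z a₀ := by
      unfold Free.eDistF
      fun_prop
    exact hc.continuousAt.eventually_lt_const (by simp [Free.eDistF])
  obtain ⟨ρ, hρ, hball⟩ := Metric.eventually_nhds_iff.1 (hvel.and (hdG.and hdF))
  obtain ⟨δ, hδ, hδδ₂, hδρ, hδK⟩ : ∃ δ : ℝ, 0 < δ ∧ δ ≤ δ₂ ∧ δ < ρ / 2 ∧ K * δ ≤ ρ / 2 := by
    refine ⟨min δ₂ (min (ρ / 4) (ρ / 2 / K)), by positivity, min_le_left _ _, ?_, ?_⟩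
    · have : min δ₂ (min (ρ / 4) (ρ / 2 / K)) ≤ ρ / 4 :=
        (min_le_right _ _).trans (min_le_left _ _)
      linarith
    · have : min δ₂ (min (ρ / 4) (ρ / 2 / K)) ≤ ρ / 2 / K :=
        (min_le_right _ _).trans (min_le_right _ _)
      rw [le_div_iff₀ hKpos] at this
      linarith
  have hsub : Set.Icc (-δ) δ ⊆ Set.Icc (-δ₂) δ₂ := Set.Icc_subset_Icc (by linarith) hδδ₂
  have h0mem : (0 : ℝ) ∈ Set.Icc (-δ) δ := ⟨by linarith, hδ.le⟩
  refine ⟨1 + δ, δ, hδ, by linarith, fun j hj => ?_⟩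
  obtain ⟨E, hE⟩ := hE j hj
  have key : ∀ a : Free.F m, ∃ γ : ℝ → Free.F m, piFG B a ∈ U → Free.eDistF a a₀ ≤ δ →
      γ 0 = a ∧ ∀ t ∈ Set.Icc (-δ) δ, piFG B (γ t) = E (piFG B a) t ∧
        Free.eDistF (γ t) a₀ ≤ 1 + δ ∧
        HasDerivWithinAt γ (liftVec φ j (E (piFG B a) t)) (Set.Icc (-δ) δ) t := by
    intro a
    by_cases ha : piFG B a ∈ U ∧ Free.eDistF a a₀ ≤ δ
    swap
    · exact ⟨fun _ => a, fun h1 h2 => absurd ⟨h1, h2⟩ ha⟩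
    obtain ⟨haU, haδ⟩ := ha
    have hanorm : ‖a - a₀‖ ≤ δ := (norm_sub_le_eDistF a a₀).trans haδ
    have hnear : ∀ z : Free.F m, ‖z - a‖ ≤ K * δ → dist z a₀ < ρ := fun z hz => by
      have := dist_triangle z a a₀
      rw [dist_eq_norm z a, dist_eq_norm a a₀] at this
      linarith
    have haG : Step2.eDist (piFG B a) (piFG B a₀) ≤ δ₂ :=
      (hball (hnear a (by simpa using by positivity))).2.1.le
    obtain ⟨hEU, hE0, hEd, -⟩ := hE (piFG B a) haU haG
    have hEd' : ∀ t ∈ Set.Icc (-δ) δ, HasDerivWithinAt (E (piFG B a))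
        (Step2.Dvec B φ j (E (piFG B a) t)) (Set.Icc (-δ) δ) t :=
      fun t ht => (hEd t (hsub ht)).mono hsub
    have hEc : ContinuousOn (E (piFG B a)) (Set.Icc (-δ) δ) :=
      fun t ht => (hEd' t ht).continuousWithinAt
    obtain ⟨γ, hγ0, hγ⟩ := exists_primitive_Icc hδ.le
      ((continuousOn_liftVec hφ j).comp hEc (fun t ht => (hEU t (hsub ht)).1)) a
    have hlift : ∀ t ∈ Set.Icc (-δ) δ, piFG B (γ t) = E (piFG B a) t := by
      refine eqOn_of_hasDerivWithinAt_eq (f := fun t => piFG B (γ t)) (fun t ht => ?_) hEd'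
        (by rw [hγ0, hE0])
      have := (piFGL B).hasFDerivAt.comp_hasDerivWithinAt t (hγ t ht)
      rw [piFGL_apply, Function.comp_apply, piFG_liftVec hskew φ hj] at this
      exact this
    have hclose := norm_sub_le_of_speed_lt_near_symm hKpos.le hγ fun t ht hle => by
      rw [hγ0] at hle
      have hv := (hball (hnear _ hle)).1 (by rw [hlift t ht]; exact (hEU t (hsub ht)).1)
      rw [hlift t ht] at hv
      exact (norm_le_pi_norm (fun j => liftVec φ j (E (piFG B a) t)) j).trans_lt hv
    refine ⟨γ, fun _ _ => ⟨hγ0, fun t ht => ⟨hlift t ht, ?_, hγ t ht⟩⟩⟩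
    have hc := hclose t ht
    rw [hγ0] at hc
    linarith [(hball (hnear _ hc)).2.2]
  choose Γ hΓ using key
  refine ⟨Γ, fun a haU haδ => ?_⟩
  obtain ⟨hΓ0, hΓt⟩ := hΓ a haU haδ
  have haG : Step2.eDist (piFG B a) (piFG B a₀) ≤ δ₂ := by
    refine (hball ?_).2.1.le
    rw [dist_eq_norm]
    linarith [norm_sub_le_eDistF a a₀]
  obtain ⟨hEU, hE0, -, hEi⟩ := hE (piFG B a) haU haG
  refine ⟨fun t ht => ⟨?_, (hΓt t ht).2.1⟩, hΓ0, fun t ht => ?_, fun t ht => ?_⟩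
  · rw [Set.mem_preimage, (hΓt t ht).1]
    exact (hEU t (hsub ht)).1
  · have := (hΓt t ht).2.2
    rw [← (hΓt t ht).1] at this
    exact this
  · simp only [(hΓt t ht).1]
    rw [hEi t (hsub ht)]
    refine intervalIntegral.integral_congr fun s hs => ?_
    simp only [(hΓt s (Set.uIcc_subset_Icc h0mem ht hs)).1]
end

section
/- Let ψ := φ∘π be defined on V := {w ∈ W_F : π(w) ∈ U}. If ψ is vertically broad* Hölder on V, then φ is vertically broad* Hölder on U. -/
open MeasureTheory Filter Topology

open Lift

/-- Telescoping one coordinate at a time inside a box. -/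
theorem abs_sub_le_sum_of_coordinatewise {ι : Type*} [Fintype ι] (s : ι → Set ℝ)
    (f : (ι → ℝ) → ℝ) (ω : ℝ → ℝ) (hω : ∀ t, 0 ≤ ω t) (ρ : ι → ℝ)
    (hf : ∀ l, ∀ p ∈ Set.univ.pi s, ∀ q ∈ Set.univ.pi s, (∀ l', l' ≠ l → p l' = q l') →
      0 < |p l - q l| → |p l - q l| ≤ ρ l → |f p - f q| ≤ ω |p l - q l|)
    {p q : ι → ℝ} (hp : p ∈ Set.univ.pi s) (hq : q ∈ Set.univ.pi s)
    (hpq : ∀ l, |p l - q l| ≤ ρ l) :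
    |f p - f q| ≤ ∑ l, ω |p l - q l| := by
  classical
  suffices h : ∀ A : Finset ι, |f p - f (A.piecewise q p)| ≤ ∑ l ∈ A, ω |p l - q l| by
    simpa using h Finset.univ
  have hbox : ∀ A : Finset ι, A.piecewise q p ∈ Set.univ.pi s := fun A l _ => by
    by_cases hl : l ∈ A
    · simpa [hl] using hq l trivial
    · simpa [hl] using hp l trivial
  intro A
  induction A using Finset.induction_on with
  | empty => simp
  | insert l A hl ih =>
    rw [Finset.sum_insert hl]
    have hstep : |f (A.piecewise q p) - f ((insert l A).piecewise q p)| ≤ ω |p l - q l| := by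
      by_cases h : p l = q l
      · have : (insert l A).piecewise q p = A.piecewise q p := by
          rw [Finset.piecewise_insert, ← h]
          ext l'
          by_cases hl' : l' = l
          · subst hl'; simp [hl]
          · simp [hl']
        simpa [this] using hω _
      · have := hf l _ (hbox A) _ (hbox (insert l A))
          (fun l' hl' => by simp [hl'])
        simp only [Finset.piecewise_eq_of_notMem A q p hl,
          Finset.piecewise_eq_of_mem (insert l A) q p (Finset.mem_insert_self l A)] at this
        exact this (abs_pos.2 (sub_ne_zero.2 h)) (hpq l)
    have := abs_sub_le (f p) (f (A.piecewise q p)) (f ((insert l A).piecewise q p))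
    linarith

/-- The strictly lower triangular parts of linearly independent skew-symmetric matrices are
linearly independent. -/
theorem linearIndependent_lower_of_skew {m h : ℕ} {B : Fin h → Matrix (Fin m) (Fin m) ℝ}
    (hskew : ∀ i, (B i).transpose = - B i) (hB : LinearIndependent ℝ B) :
    LinearIndependent ℝ (fun i (ls : Free.VIdx m) => B i ls.1.1 ls.1.2) := by
  rw [Fintype.linearIndependent_iff] at hB ⊢
  intro g hg
  apply hB g
  have hlow : ∀ j k : Fin m, k < j → ∑ i, g i * B i j k = 0 := fun j k hkj => by
    simpa [Finset.sum_apply] using congrFun hg ⟨(j, k), hkj⟩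
  have hsk : ∀ i j k, B i j k = - B i k j := fun i j k => congrFun (congrFun (hskew i) k) j
  ext j k
  simp only [Matrix.sum_apply, Matrix.smul_apply, smul_eq_mul, Matrix.zero_apply]
  rcases lt_trichotomy j k with hjk | rfl | hkj
  · simp_rw [fun i => hsk i j k, mul_neg, Finset.sum_neg_distrib, hlow k j hjk, neg_zero]
  · refine Finset.sum_eq_zero fun i _ => ?_
    rw [show B i j j = 0 by linarith [hsk i j j], mul_zero]
  · exact hlow j k hkj

/-- A linear section of the vertical part of the projection `π : F → G`. -/
theorem exists_linear_section_piFG {m h : ℕ} {B : Fin h → Matrix (Fin m) (Fin m) ℝ}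
    (hskew : ∀ i, (B i).transpose = - B i) (hB : LinearIndependent ℝ B) :
    ∃ S : (Fin h → ℝ) →ₗ[ℝ] (Free.VIdx m → ℝ),
      ∀ x y, piFG B (x, S y) = (x, y) := by
  let M : Matrix (Fin h) (Free.VIdx m) ℝ := .of fun i ls => B i ls.1.1 ls.1.2
  have hM : M.rank = Fintype.card (Fin h) :=
    LinearIndependent.rank_matrix (linearIndependent_lower_of_skew hskew hB)
  have hsurj : LinearMap.range M.mulVecLin = ⊤ :=
    Submodule.eq_top_of_finrank_eq (by simpa [Matrix.rank] using hM)
  obtain ⟨S, hS⟩ := M.mulVecLin.exists_rightInverse_of_surjective hsurj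
  exact ⟨S, fun x y => Prod.ext rfl (LinearMap.congr_fun hS y)⟩

/-- Let `ψ := φ∘π` on `V := π⁻¹(U)`. If `ψ` is vertically broad* Hölder
on `V`, then `φ` is vertically broad* Hölder on `U`. -/
theorem statement16 (m h : ℕ) [NeZero m] (hm : 2 ≤ m) (hh : 1 ≤ h)
    (B : Fin h → Matrix (Fin m) (Fin m) ℝ)
    (hskew : ∀ i, (B i).transpose = - B i) (hBli : LinearIndependent ℝ B)
    (U : Set (Step2.G m h)) (hUW : U ⊆ Step2.Wset m h) (hUopen : Step2.RelOpen m h U)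
    (φ : Step2.G m h → ℝ) (hφ : ContinuousOn φ U)
    (hvertF : Free.VertHolderF m (piFG B ⁻¹' U) (fun w => φ (piFG B w))) :
    Step2.VertHolder m h U φ := by
  intro a₀ ha₀
  obtain ⟨S, hS⟩ := exists_linear_section_piFG hskew hBli
  obtain ⟨O, hO, rfl⟩ := hUopen
  let σ : Step2.G m h → Free.F m := fun p => (p.1, S p.2)
  have hσ : Continuous σ :=
    continuous_fst.prodMk (S.continuous_of_finiteDimensional.comp continuous_snd)
  obtain ⟨V', ⟨O', hO', rfl⟩, haV, -, -, hH⟩ := hvertF (σ a₀) (by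
    simpa only [Set.mem_preimage, σ, hS] using ha₀)
  obtain ⟨r, hr, hrO⟩ := Metric.isOpen_iff.1 hO' _ haV.1
  obtain ⟨δ₁, hδ₁, hδσ⟩ := Metric.isOpen_iff.1 (Metric.isOpen_ball.preimage hσ) a₀
    (Metric.mem_ball_self (x := σ a₀) hr)
  obtain ⟨δ₂, hδ₂, hδO⟩ := Metric.nhds_basis_closedBall.mem_iff.1 (hO.mem_nhds ha₀.1)
  set δ := min δ₁ δ₂
  have hδ : 0 < δ := lt_min hδ₁ hδ₂
  have hW : IsClosed (Step2.Wset m h) :=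
    isClosed_eq ((continuous_apply 0).comp continuous_fst) continuous_const
  have hcl : closure (Metric.ball a₀ δ ∩ Step2.Wset m h) ⊆
      Metric.closedBall a₀ δ ∩ Step2.Wset m h :=
    closure_minimal (Set.inter_subset_inter_left _ Metric.ball_subset_closedBall)
      (Metric.isClosed_closedBall.inter hW)
  refine ⟨Metric.ball a₀ δ ∩ Step2.Wset m h, ⟨_, Metric.isOpen_ball, rfl⟩,
    ⟨Metric.mem_ball_self hδ, ha₀.2⟩,
    (isCompact_closedBall a₀ δ).of_isClosed_subset isClosed_closure
      (hcl.trans Set.inter_subset_left),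
    hcl.trans (Set.inter_subset_inter_left _
      ((Metric.closedBall_subset_closedBall (min_le_right _ _)).trans hδO)), ?_⟩
  intro i ε hε
  set v := S (Pi.single i 1)
  set N : ℝ := ((Fintype.card (Free.VIdx m) : ℕ) : ℝ)
  set D : ℝ := N * Real.sqrt ‖v‖ + 1
  have hD : 0 < D := by positivity
  choose ρ hρ hρH using fun ls => hH ls (ε / D) (by positivity)
  obtain ⟨ρ₀, hρ₀, hρ₀'⟩ : ∃ ρ₀ > (0 : ℝ), ∀ ls, ρ₀ * ‖v‖ ≤ ρ ls := by
    have h : ∀ᶠ t : ℝ in 𝓝[>] 0, ∀ ls, t * ‖v‖ ≤ ρ ls := by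
      refine eventually_all.2 fun ls => ?_
      have : Tendsto (fun t : ℝ => t * ‖v‖) (𝓝[>] 0) (𝓝 0) := by
        have : Continuous fun t : ℝ => t * ‖v‖ := by fun_prop
        simpa using (this.tendsto 0).mono_left nhdsWithin_le_nhds
      exact this.eventually_le_const (hρ ls)
    obtain ⟨t, ht, ht'⟩ := (h.and self_mem_nhdsWithin).exists
    exact ⟨t, ht', ht⟩
  refine ⟨ρ₀, hρ₀, fun p hp q hq h1 h2 _ hle => ?_⟩
  set t := p.2 i - q.2 i
  have hdiff : S p.2 - S q.2 = t • v := by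
    rw [← map_sub, ← map_smul]
    congr 1
    ext i'
    by_cases hi : i' = i
    · subst hi; simp [t]
    · simp [hi, h2 i' hi]
  have hls : ∀ ls, |S p.2 ls - S q.2 ls| ≤ |t| * ‖v‖ := fun ls => by
    rw [← Pi.sub_apply, hdiff, Pi.smul_apply, smul_eq_mul, abs_mul]
    exact mul_le_mul_of_nonneg_left (norm_le_pi_norm v ls) (abs_nonneg t)
  have hmem : ∀ w ∈ Metric.ball a₀ δ ∩ Step2.Wset m h,
      w.1 ∈ Metric.ball a₀.1 r ∧ S w.2 ∈ Set.univ.pi fun ls => Metric.ball (S a₀.2 ls) r := by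
    intro w hw
    have := hδσ (Metric.ball_subset_ball (min_le_left _ _) hw.1)
    rwa [Set.mem_preimage, ← ball_prod_same, Set.mem_prod, ball_pi (S a₀.2) hr] at this
  have hbox : ∀ y ∈ Set.univ.pi (fun ls => Metric.ball (S a₀.2 ls) r),
      (p.1, y) ∈ O' ∩ Free.WsetF m := fun y hy => by
    refine ⟨hrO ?_, hp.2⟩
    rw [← ball_prod_same, Set.mem_prod, ball_pi (S a₀.2) hr]
    exact ⟨(hmem p hp).1, hy⟩
  have key := abs_sub_le_sum_of_coordinatewise (fun ls => Metric.ball (S a₀.2 ls) r)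
    (fun y => φ (piFG B (p.1, y))) (fun s => ε / D * Real.sqrt s)
    (fun s => by positivity) ρ
    (fun ls y hy z hz => hρH ls _ (hbox y hy) _ (hbox z hz) rfl)
    (hmem p hp).2 (hmem q hq).2
    (fun ls => (hls ls).trans
      ((mul_le_mul_of_nonneg_right hle (norm_nonneg v)).trans (hρ₀' ls)))
  have hq' : ((p.1, q.2) : Step2.G m h) = q := Prod.ext h1 rfl
  simp only [hS, hq'] at key
  calc |φ p - φ q| ≤ ∑ ls, ε / D * Real.sqrt |S p.2 ls - S q.2 ls| := key
    _ ≤ ∑ _ls : Free.VIdx m, ε / D * (Real.sqrt |t| * Real.sqrt ‖v‖) := by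
        gcongr with ls
        rw [← Real.sqrt_mul (abs_nonneg t)]
        exact Real.sqrt_le_sqrt (hls ls)
    _ = (N * Real.sqrt ‖v‖) / D * (ε * Real.sqrt |t|) := by
        rw [Finset.sum_const, Finset.card_univ, nsmul_eq_mul]
        ring
    _ ≤ 1 * (ε * Real.sqrt |t|) := by
        gcongr
        exact (div_le_one hD).2 (by simp [D])
    _ = ε * Real.sqrt |t| := one_mul _
end
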